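/- For every z∈ℂ∖[0,+∞) there exists a constant C_z such that sup_{ξ∈ℝⁿ} ‖(P̂₀(ξ)−z)^{−1}‖_{ℬ(L²(ℝⁿ_v))} ≤ C_z; consequently the spectrum of P₀ on L²(ℝ^{2n}) equals the union over ξ∈ℝⁿ of the spectra of P̂₀(ξ), namely σ(P₀) = [0,+∞). -/

import Mathlib

open MeasureTheory Real Complex Filter Topology

noncomputable section

/-- ℝⁿ (velocity variables) -/
abbrev Ev (n : ℕ) := EuclideanSpace ℝ (Fin n)
/-- L²(ℝⁿ_v) -/
abbrev HV (n : ℕ) := Lp ℂ 2 (volume : Measure (Ev n))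

/-- test functions on ℝⁿ_v -/
def IsTestV (n : ℕ) (φ : Ev n → ℂ) : Prop := ContDiff ℝ (⊤ : ℕ∞) φ ∧ HasCompactSupport φ

def djV (n : ℕ) (u : Ev n → ℂ) (j : Fin n) (v : Ev n) : ℂ :=
  fderiv ℝ u v (EuclideanSpace.single j 1)

def lapV (n : ℕ) (u : Ev n → ℂ) (v : Ev n) : ℂ :=
  ∑ j : Fin n, djV n (fun w => djV n u j w) j v

/-- the complex harmonic oscillator P̂₀(ξ) = −Δᵥ + v²/4 − n/2 + i v·ξ (it coincides with
its formal transpose w.r.t. the bilinear pairing ∫ u φ) -/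
def Phat0t (n : ℕ) (ξ : Ev n) (φ : Ev n → ℂ) (v : Ev n) : ℂ :=
  -lapV n φ v + ((‖v‖ ^ 2 / 4 - (n : ℝ) / 2 : ℝ) : ℂ) * φ v
    + Complex.I * (((∑ j : Fin n, v j * ξ j : ℝ)) : ℂ) * φ v

/-- R is the resolvent (P̂₀(ξ) − z)^{−1}, in the distributional sense -/
def IsResV (n : ℕ) (ξ : Ev n) (z : ℂ) (R : HV n →L[ℂ] HV n) : Prop :=
  ∀ f : HV n, ∀ φ : Ev n → ℂ, IsTestV n φ →
    ∫ v : Ev n, (R f) v * (Phat0t n ξ φ v - z * φ v) = ∫ v : Ev n, f v * φ v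

/-- normalized Hermite function φ_j = (j!√(2π))^{−1/2} e^{−s²/4} F_j(s), extended to
complex arguments (F_j = probabilists' Hermite polynomial). -/
def phiC (j : ℕ) (z : ℂ) : ℂ :=
  ((((Nat.factorial j : ℝ) * Real.sqrt (2 * π)) ^ (-(1:ℝ)/2) : ℝ) : ℂ)
    * Complex.exp (-z ^ 2 / 4) * Polynomial.aeval z (Polynomial.hermite j)

/-- ψ_α at complex arguments -/
def psiCN (n : ℕ) (α : Fin n → ℕ) (w : Fin n → ℂ) : ℂ := ∏ j : Fin n, phiC (α j) (w j)

/-- ψ_α^ξ(v) = ψ_α(v + 2iξ) -/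
def psiXi (n : ℕ) (α : Fin n → ℕ) (ξ : Ev n) (v : Ev n) : ℂ :=
  psiCN n α (fun j => ((v j : ℝ) : ℂ) + 2 * Complex.I * ((ξ j : ℝ) : ℂ))

/-- phase space ℝ^{2n} -/
abbrev PhaseN (n : ℕ) := Ev n × Ev n
/-- L²(ℝ^{2n}) -/
abbrev HspN (n : ℕ) := Lp ℂ 2 (volume : Measure (PhaseN n))

def IsTestN (n : ℕ) (φ : PhaseN n → ℂ) : Prop := ContDiff ℝ (⊤ : ℕ∞) φ ∧ HasCompactSupport φ

def dxjN (n : ℕ) (u : PhaseN n → ℂ) (j : Fin n) (p : PhaseN n) : ℂ :=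
  fderiv ℝ u p (EuclideanSpace.single j 1, 0)
def dvjN (n : ℕ) (u : PhaseN n → ℂ) (j : Fin n) (p : PhaseN n) : ℂ :=
  fderiv ℝ u p (0, EuclideanSpace.single j 1)

def lapvN (n : ℕ) (u : PhaseN n → ℂ) (p : PhaseN n) : ℂ :=
  ∑ j : Fin n, dvjN n (fun q => dvjN n u j q) j p

/-- formal transpose of the free KFP operator P₀ = v·∇ₓ − Δᵥ + |v|²/4 − n/2 -/
def KFP0tN (n : ℕ) (φ : PhaseN n → ℂ) (p : PhaseN n) : ℂ :=
  -(∑ j : Fin n, (p.2 j : ℂ) * dxjN n φ j p) - lapvN n φ p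
    + ((‖p.2‖ ^ 2 / 4 - (n : ℝ) / 2 : ℝ) : ℂ) * φ p

section CCR

variable {n : ℕ} {V H : Type*} [AddCommGroup V] [Module ℂ V]
  [NormedAddCommGroup H] [InnerProductSpace ℂ H]

/-- Annihilation operators `a j` and creation operators `ad j` on a complex vector space `V`,
formally adjoint to each other for the inner product pulled back along the injection `e`, and
satisfying the canonical commutation relations. -/
structure CCRSystem (n : ℕ) (V H : Type*) [AddCommGroup V] [Module ℂ V]
    [NormedAddCommGroup H] [InnerProductSpace ℂ H] where
  a : Fin n → V →ₗ[ℂ] V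
  ad : Fin n → V →ₗ[ℂ] V
  e : V →ₗ[ℂ] H
  inj : ∀ u, e u = 0 → u = 0
  adj : ∀ j u w, inner ℂ (e (a j u)) (e w) = inner ℂ (e u) (e (ad j w))
  comm : ∀ j k u, a j (ad k u) = ad k (a j u) + if j = k then u else 0
  comm_a : ∀ j k u, a j (a k u) = a k (a j u)
  comm_ad : ∀ j k u, ad j (ad k u) = ad k (ad j u)

namespace CCRSystem

variable (L : CCRSystem n V H)

lemma adj' (j : Fin n) (u w : V) :
    inner ℂ (L.e (L.ad j u)) (L.e w) = inner ℂ (L.e u) (L.e (L.a j w)) := by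
  rw [← inner_conj_symm, ← L.adj, inner_conj_symm]

lemma norm_ad_sq (j : Fin n) (u : V) :
    ‖L.e (L.ad j u)‖ ^ 2 = ‖L.e (L.a j u)‖ ^ 2 + ‖L.e u‖ ^ 2 := by
  have h : inner ℂ (L.e (L.ad j u)) (L.e (L.ad j u))
      = inner ℂ (L.e (L.a j u)) (L.e (L.a j u)) + inner ℂ (L.e u) (L.e u) := by
    rw [L.adj', L.comm, L.adj, if_pos rfl, map_add, inner_add_right]
  have := congrArg Complex.re h
  simpa [inner_self_eq_norm_sq_to_K, ← Complex.ofReal_pow] using this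

/-- The number operator `∑ ad j * a j`. -/
def num : V →ₗ[ℂ] V := ∑ j, L.ad j ∘ₗ L.a j

lemma num_apply (u : V) : L.num u = ∑ j, L.ad j (L.a j u) := by
  simp [num]

lemma a_num (j : Fin n) (u : V) : L.a j (L.num u) = L.num (L.a j u) + L.a j u := by
  simp only [num_apply, map_sum, L.comm, Finset.sum_add_distrib, L.comm_a j]
  simp

lemma num_ad (j : Fin n) (u : V) : L.num (L.ad j u) = L.ad j (L.num u) + L.ad j u := by
  have h (k : Fin n) : L.ad k (L.a k (L.ad j u))
      = L.ad j (L.ad k (L.a k u)) + if k = j then L.ad k u else 0 := by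
    rw [L.comm, map_add, L.comm_ad]
    split_ifs <;> simp
  simp only [num_apply, map_sum, h, Finset.sum_add_distrib]
  simp

lemma inner_num (u w : V) :
    inner ℂ (L.e (L.num u)) (L.e w) = ∑ j, inner ℂ (L.e (L.a j u)) (L.e (L.a j w)) := by
  simp only [num_apply, L.adj', map_sum, sum_inner]

/-- The shift of the annihilation operators by `-i ξ`. -/
def shift (ξ : Ev n) : CCRSystem n V H where
  a j := L.a j - (Complex.I * (ξ j : ℂ)) • LinearMap.id
  ad j := L.ad j + (Complex.I * (ξ j : ℂ)) • LinearMap.id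
  e := L.e
  inj := L.inj
  adj j u w := by
    simp only [LinearMap.sub_apply, LinearMap.add_apply, LinearMap.smul_apply, LinearMap.id_apply,
      map_sub, map_add, map_smul, inner_sub_left, inner_add_right, inner_smul_left,
      inner_smul_right, L.adj]
    simp
  comm j k u := by
    simp only [LinearMap.sub_apply, LinearMap.add_apply, LinearMap.smul_apply, LinearMap.id_apply,
      map_sub, map_add, map_smul, L.comm]
    module
  comm_a j k u := by
    simp only [LinearMap.sub_apply, LinearMap.smul_apply, LinearMap.id_apply,
      map_sub, map_smul, L.comm_a j k]
    module
  comm_ad j k u := by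
    simp only [LinearMap.add_apply, LinearMap.smul_apply, LinearMap.id_apply,
      map_add, map_smul, L.comm_ad j k]
    module

/-- The operator `∑ j, ξ j * a j`. -/
def lower (ξ : Ev n) : V →ₗ[ℂ] V := ∑ j, (ξ j : ℂ) • L.a j

/-- The operator `∑ j, ξ j * ad j`. -/
def raise (ξ : Ev n) : V →ₗ[ℂ] V := ∑ j, (ξ j : ℂ) • L.ad j

lemma lower_apply (ξ : Ev n) (u : V) : L.lower ξ u = ∑ j, (ξ j : ℂ) • L.a j u := by
  simp [lower]

lemma raise_apply (ξ : Ev n) (u : V) : L.raise ξ u = ∑ j, (ξ j : ℂ) • L.ad j u := by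
  simp [raise]

lemma inner_lower (ξ : Ev n) (u w : V) :
    inner ℂ (L.e (L.lower ξ u)) (L.e w) = inner ℂ (L.e u) (L.e (L.raise ξ w)) := by
  simp only [lower_apply, raise_apply, map_sum, map_smul, sum_inner, inner_sum, inner_smul_left,
    inner_smul_right, L.adj, Complex.conj_ofReal]

lemma inner_raise (ξ : Ev n) (u w : V) :
    inner ℂ (L.e (L.raise ξ u)) (L.e w) = inner ℂ (L.e u) (L.e (L.lower ξ w)) := by
  rw [← inner_conj_symm, ← L.inner_lower, inner_conj_symm]

lemma a_raise (ξ : Ev n) (j : Fin n) (u : V) :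
    L.a j (L.raise ξ u) = L.raise ξ (L.a j u) + (ξ j : ℂ) • u := by
  simp only [raise_apply, map_sum, map_smul, L.comm, smul_add, Finset.sum_add_distrib, smul_ite,
    smul_zero]
  simp

lemma a_lower (ξ : Ev n) (j : Fin n) (u : V) : L.a j (L.lower ξ u) = L.lower ξ (L.a j u) := by
  simp only [lower_apply, map_sum, map_smul, L.comm_a j]

lemma sum_mul_self (ξ : Ev n) : ∑ j, (ξ j : ℂ) * (ξ j : ℂ) = ((‖ξ‖ ^ 2 : ℝ) : ℂ) := by
  rw [EuclideanSpace.real_norm_sq_eq]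
  push_cast
  exact Finset.sum_congr rfl fun j _ => by ring

lemma lower_raise (ξ : Ev n) (u : V) :
    L.lower ξ (L.raise ξ u) = L.raise ξ (L.lower ξ u) + ((‖ξ‖ ^ 2 : ℝ) : ℂ) • u := by
  rw [L.lower_apply ξ (L.raise ξ u), L.lower_apply ξ u]
  simp only [a_raise, map_sum, map_smul, smul_add, Finset.sum_add_distrib, smul_smul,
    ← Finset.sum_smul, sum_mul_self]

lemma norm_lower_sq_le (ξ : Ev n) (u : V) :
    ‖L.e (L.lower ξ u)‖ ^ 2 ≤ ‖ξ‖ ^ 2 * ∑ j, ‖L.e (L.a j u)‖ ^ 2 := by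
  have h1 : ‖L.e (L.lower ξ u)‖ ≤ ∑ j, |ξ j| * ‖L.e (L.a j u)‖ := by
    rw [lower_apply, map_sum]
    refine (norm_sum_le _ _).trans (Finset.sum_le_sum fun j _ => ?_)
    rw [map_smul, norm_smul, Complex.norm_real, Real.norm_eq_abs]
  calc ‖L.e (L.lower ξ u)‖ ^ 2 ≤ (∑ j, |ξ j| * ‖L.e (L.a j u)‖) ^ 2 := by gcongr
    _ ≤ (∑ j, |ξ j| ^ 2) * ∑ j, ‖L.e (L.a j u)‖ ^ 2 := Finset.sum_mul_sq_le_sq_mul_sq _ _ _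
    _ = _ := by rw [EuclideanSpace.real_norm_sq_eq]; simp only [sq_abs]

lemma norm_raise_sq (ξ : Ev n) (u : V) :
    ‖L.e (L.raise ξ u)‖ ^ 2 = ‖L.e (L.lower ξ u)‖ ^ 2 + ‖ξ‖ ^ 2 * ‖L.e u‖ ^ 2 := by
  have h : inner ℂ (L.e (L.raise ξ u)) (L.e (L.raise ξ u))
      = inner ℂ (L.e (L.lower ξ u)) (L.e (L.lower ξ u))
        + ((‖ξ‖ ^ 2 : ℝ) : ℂ) * inner ℂ (L.e u) (L.e u) := by
    rw [L.inner_raise, L.lower_raise, L.inner_lower, map_add, inner_add_right, map_smul,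
      inner_smul_right]
  have := congrArg Complex.re h
  simpa [inner_self_eq_norm_sq_to_K, ← Complex.ofReal_pow, -map_pow, ← Complex.ofReal_mul] using this

/-- The position operator `∑ j, ξ j * (a j + ad j)` in the direction `ξ`. -/
def position (ξ : Ev n) : V →ₗ[ℂ] V := L.lower ξ + L.raise ξ

lemma inner_position (ξ : Ev n) (u w : V) :
    inner ℂ (L.e (L.position ξ u)) (L.e w) = inner ℂ (L.e u) (L.e (L.position ξ w)) := by
  simp only [position, LinearMap.add_apply, map_add, inner_add_left, inner_add_right,
    inner_lower, inner_raise]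
  ring

lemma a_position (ξ : Ev n) (j : Fin n) (u : V) :
    L.a j (L.position ξ u) = L.position ξ (L.a j u) + (ξ j : ℂ) • u := by
  simp only [position, LinearMap.add_apply, map_add, a_lower, a_raise]
  abel

lemma im_inner_position (ξ : Ev n) (u : V) :
    (inner ℂ (L.e u) (L.e (L.position ξ u))).im = 0 := by
  have := L.inner_position ξ u u
  rw [← inner_conj_symm] at this
  exact Complex.conj_eq_iff_im.mp this

/-- The complex harmonic oscillator `∑ ad j * a j + i ξ · (a + ad)`. -/
def osc (ξ : Ev n) : V →ₗ[ℂ] V := L.num + Complex.I • L.position ξ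

lemma osc_apply (ξ : Ev n) (u : V) : L.osc ξ u = L.num u + Complex.I • L.position ξ u := rfl

lemma re_inner_osc (ξ : Ev n) (u : V) :
    (inner ℂ (L.e u) (L.e (L.osc ξ u))).re = ∑ j, ‖L.e (L.a j u)‖ ^ 2 := by
  rw [osc_apply, map_add, inner_add_right, map_smul, inner_smul_right, ← inner_conj_symm,
    inner_num, Complex.add_re, Complex.mul_re, im_inner_position]
  simp [inner_self_eq_norm_sq_to_K, ← Complex.ofReal_pow]

lemma norm_position_sq_le (ξ : Ev n) (u : V) :
    ‖L.e (L.position ξ u)‖ ^ 2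
      ≤ ‖L.e (L.osc ξ u)‖ ^ 2 + 2 * (‖L.e (L.lower ξ u)‖ * ‖L.e u‖) := by
  have h1 : inner ℂ (L.e (L.num u)) (L.e (L.position ξ u))
      = ∑ j, inner ℂ (L.e (L.a j u)) (L.e (L.position ξ (L.a j u)))
        + inner ℂ (L.e (L.lower ξ u)) (L.e u) := by
    simp only [inner_num, a_position, map_add, inner_add_right, Finset.sum_add_distrib, map_smul,
      inner_smul_right, lower_apply, map_sum, sum_inner, inner_smul_left, Complex.conj_ofReal]
  have h2 : (inner ℂ (L.e (L.num u)) (L.e (L.position ξ u))).im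
      = (inner ℂ (L.e (L.lower ξ u)) (L.e u)).im := by
    rw [h1, Complex.add_im, Complex.im_sum]
    simp [im_inner_position]
  have h3 : ‖L.e (L.osc ξ u)‖ ^ 2 = ‖L.e (L.num u)‖ ^ 2
      + 2 * (inner ℂ (L.e (L.num u)) (Complex.I • L.e (L.position ξ u))).re
      + ‖L.e (L.position ξ u)‖ ^ 2 := by
    rw [osc_apply, map_add, map_smul, @norm_add_sq ℂ, norm_smul, Complex.norm_I, one_mul]
    rfl
  rw [inner_smul_right, Complex.mul_re, Complex.I_re, Complex.I_im, h2] at h3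
  have h4 := (Complex.abs_im_le_norm (inner ℂ (L.e (L.lower ξ u)) (L.e u))).trans
    (norm_inner_le_norm _ _)
  have h5 := abs_le.mp h4
  nlinarith [sq_nonneg ‖L.e (L.num u)‖, h5.1, h5.2]

lemma sq_norm_mul_norm_sq_le (ξ : Ev n) (u : V) :
    ‖ξ‖ ^ 2 * ‖L.e u‖ ^ 2
      ≤ ‖L.e (L.position ξ u)‖ * (‖L.e (L.lower ξ u)‖ + ‖L.e (L.raise ξ u)‖) := by
  have h1 : L.lower ξ (L.position ξ u) = L.position ξ (L.lower ξ u) + ((‖ξ‖ ^ 2 : ℝ) : ℂ) • u := by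
    simp only [position, LinearMap.add_apply, map_add, lower_raise]
    abel
  have h2 : ((‖ξ‖ ^ 2 : ℝ) : ℂ) * inner ℂ (L.e u) (L.e u)
      = inner ℂ (L.e (L.raise ξ u)) (L.e (L.position ξ u))
        - inner ℂ (L.e (L.position ξ u)) (L.e (L.lower ξ u)) := by
    rw [L.inner_raise, h1, L.inner_position, map_add, inner_add_right, map_smul, inner_smul_right]
    ring
  have h3 : ‖ξ‖ ^ 2 * ‖L.e u‖ ^ 2 = ‖((‖ξ‖ ^ 2 : ℝ) : ℂ) * inner ℂ (L.e u) (L.e u)‖ := by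
    rw [norm_mul, inner_self_eq_norm_sq_to_K]
    simp
  rw [h3, h2]
  refine (norm_sub_le _ _).trans ?_
  have := norm_inner_le_norm (𝕜 := ℂ) (L.e (L.raise ξ u)) (L.e (L.position ξ u))
  have := norm_inner_le_norm (𝕜 := ℂ) (L.e (L.position ξ u)) (L.e (L.lower ξ u))
  linarith

/-- Subellipticity: the complex harmonic oscillators are uniformly large for large `ξ`. -/
lemma le_norm_osc (K : ℝ) (hK : 1 ≤ K) :
    ∃ M : ℝ, 0 ≤ M ∧ ∀ L : CCRSystem n V H, ∀ ξ : Ev n, M ≤ ‖ξ‖ → ∀ u,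
      K * ‖L.e u‖ ≤ ‖L.e (L.osc ξ u)‖ := by
  refine ⟨(2 * K + 1) ^ 2 * (K ^ 2 + 2 * K) + 1, by positivity, fun L ξ hξ u => ?_⟩
  by_contra! hlt
  have hU : 0 < ‖L.e u‖ := by
    by_contra! h
    have : ‖L.e u‖ = 0 := le_antisymm h (norm_nonneg _)
    rw [this, mul_zero] at hlt
    exact absurd hlt (not_lt.mpr (norm_nonneg _))
  set t := ‖ξ‖
  set U := ‖L.e u‖
  have ht1 : 1 ≤ t := by
    have : 0 ≤ (2 * K + 1) ^ 2 * (K ^ 2 + 2 * K) := by positivity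
    linarith
  have hA : ∑ j, ‖L.e (L.a j u)‖ ^ 2 ≤ K * U ^ 2 := by
    rw [← L.re_inner_osc ξ]
    calc _ ≤ ‖inner ℂ (L.e u) (L.e (L.osc ξ u))‖ := Complex.re_le_norm _
      _ ≤ U * ‖L.e (L.osc ξ u)‖ := norm_inner_le_norm _ _
      _ ≤ U * (K * U) := by gcongr
      _ = _ := by ring
  have hB2 : ‖L.e (L.lower ξ u)‖ ^ 2 ≤ t ^ 2 * (K * U ^ 2) :=
    (L.norm_lower_sq_le ξ u).trans (by gcongr)
  have hB : ‖L.e (L.lower ξ u)‖ ≤ t * K * U := by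
    refine abs_le_of_sq_le_sq' ?_ (by positivity) |>.2
    refine hB2.trans ?_
    have : K ≤ K ^ 2 := by nlinarith
    calc t ^ 2 * (K * U ^ 2) ≤ t ^ 2 * (K ^ 2 * U ^ 2) := by gcongr
      _ = _ := by ring
  have hBd : ‖L.e (L.raise ξ u)‖ ≤ t * (K + 1) * U := by
    refine abs_le_of_sq_le_sq' ?_ (by positivity) |>.2
    rw [norm_raise_sq]
    have : K + 1 ≤ (K + 1) ^ 2 := by nlinarith
    calc _ ≤ t ^ 2 * (K * U ^ 2) + t ^ 2 * U ^ 2 := by gcongr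
      _ = t ^ 2 * ((K + 1) * U ^ 2) := by ring
      _ ≤ t ^ 2 * ((K + 1) ^ 2 * U ^ 2) := by gcongr
      _ = _ := by ring
  set x := ‖L.e (L.position ξ u)‖
  have hx0 : 0 ≤ x := norm_nonneg _
  have hx : x ^ 2 ≤ (K ^ 2 + 2 * t * K) * U ^ 2 := by
    have h1 : ‖L.e (L.osc ξ u)‖ ^ 2 ≤ (K * U) ^ 2 := by gcongr
    have h2 : ‖L.e (L.lower ξ u)‖ * U ≤ t * K * U * U := by gcongr
    have := L.norm_position_sq_le ξ u
    nlinarith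
  have h1 : t * U ≤ (2 * K + 1) * x := by
    have h2 := L.sq_norm_mul_norm_sq_le ξ u
    have h3 : t ^ 2 * U ^ 2 ≤ x * (t * K * U + t * (K + 1) * U) := by
      refine h2.trans ?_
      gcongr
    have h4 : (t * U) * (t * U) ≤ (t * U) * ((2 * K + 1) * x) := by nlinarith
    exact le_of_mul_le_mul_left h4 (by positivity)
  have h2 : t ^ 2 * U ^ 2 ≤ (2 * K + 1) ^ 2 * (K ^ 2 + 2 * t * K) * U ^ 2 := by
    calc t ^ 2 * U ^ 2 = (t * U) ^ 2 := by ring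
      _ ≤ ((2 * K + 1) * x) ^ 2 := by gcongr
      _ = (2 * K + 1) ^ 2 * x ^ 2 := by ring
      _ ≤ (2 * K + 1) ^ 2 * ((K ^ 2 + 2 * t * K) * U ^ 2) := by gcongr
      _ = _ := by ring
  have h3 : t ^ 2 ≤ (2 * K + 1) ^ 2 * (K ^ 2 + 2 * t * K) :=
    le_of_mul_le_mul_right h2 (by positivity)
  have h4 : (2 * K + 1) ^ 2 * (K ^ 2 + 2 * t * K) ≤ t * ((2 * K + 1) ^ 2 * (K ^ 2 + 2 * K)) := by
    have : K ^ 2 + 2 * t * K ≤ t * (K ^ 2 + 2 * K) := by nlinarith [sq_nonneg K]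
    calc _ ≤ (2 * K + 1) ^ 2 * (t * (K ^ 2 + 2 * K)) := by gcongr
      _ = _ := by ring
  nlinarith

/-- The oscillator in the gauge where it is `∑ ad j * a j + 2 i ξ · a + ‖ξ‖ ^ 2`. -/
def gauged (ξ : Ev n) : V →ₗ[ℂ] V :=
  L.num + (2 * Complex.I) • L.lower ξ + ((‖ξ‖ ^ 2 : ℝ) : ℂ) • LinearMap.id

lemma gauged_apply (ξ : Ev n) (u : V) : L.gauged ξ u
    = L.num u + (2 * Complex.I) • L.lower ξ u + ((‖ξ‖ ^ 2 : ℝ) : ℂ) • u := rfl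

lemma shift_osc (ξ : Ev n) (u : V) : (L.shift ξ).osc ξ u = L.gauged ξ u := by
  have hI : Complex.I * Complex.I = -1 := Complex.I_mul_I
  have h (j : Fin n) : (L.shift ξ).ad j ((L.shift ξ).a j u)
      + Complex.I • ((ξ j : ℂ) • (L.shift ξ).a j u + (ξ j : ℂ) • (L.shift ξ).ad j u)
      = L.ad j (L.a j u) + (2 * Complex.I) • (ξ j : ℂ) • L.a j u + ((ξ j : ℂ) * (ξ j : ℂ)) • u := by
    simp only [shift, LinearMap.sub_apply, LinearMap.add_apply, LinearMap.smul_apply,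
      LinearMap.id_apply, map_sub, map_smul]
    match_scalars
    · ring
    · ring
    · ring
    · linear_combination (-(ξ j : ℂ) * (ξ j : ℂ)) * hI
  rw [osc_apply, num_apply, position, LinearMap.add_apply, lower_apply, raise_apply,
    ← Finset.sum_add_distrib, Finset.smul_sum, ← Finset.sum_add_distrib,
    Finset.sum_congr rfl fun j _ => h j, gauged_apply, num_apply, lower_apply, Finset.smul_sum,
    ← sum_mul_self, Finset.sum_smul, ← Finset.sum_add_distrib, ← Finset.sum_add_distrib]

lemma a_gauged (ξ : Ev n) (j : Fin n) (u : V) :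
    L.a j (L.gauged ξ u) = L.gauged ξ (L.a j u) + L.a j u := by
  simp only [gauged_apply, map_add, map_smul, a_num, a_lower]
  abel

/-- The degree filtration generated by a vacuum vector. -/
lemma exists_filtration (vac : V) (hvac : ∀ j, L.a j vac = 0)
    (hcyc : ∀ S : Submodule ℂ V, vac ∈ S → (∀ j, ∀ u ∈ S, L.ad j u ∈ S) → S = ⊤) :
    ∃ W : ℕ → Submodule ℂ V, W 0 = ⊥ ∧ (∀ u, ∃ d, u ∈ W d) ∧
      (∀ d j, ∀ u ∈ W (d + 1), L.a j u ∈ W d) ∧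
      (∀ d : ℕ, ∀ u ∈ W (d + 1), L.num u - (d : ℂ) • u ∈ W d) := by
  let W : ℕ → Submodule ℂ V := fun d =>
    Nat.rec ⊥ (fun _ S => Submodule.span ℂ {vac} ⊔ ⨆ j, S.map (L.ad j)) d
  have hs (d : ℕ) : W (d + 1) = Submodule.span ℂ {vac} ⊔ ⨆ j, (W d).map (L.ad j) := rfl
  have hv (d : ℕ) : vac ∈ W (d + 1) :=
    hs d ▸ Submodule.mem_sup_left (Submodule.mem_span_singleton_self vac)
  have had (d : ℕ) (j : Fin n) (u : V) (hu : u ∈ W d) : L.ad j u ∈ W (d + 1) :=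
    hs d ▸ Submodule.mem_sup_right (Submodule.mem_iSup_of_mem j ⟨u, hu, rfl⟩)
  have hmono : Monotone W := by
    refine monotone_nat_of_le_succ fun d => ?_
    induction d with
    | zero => exact bot_le
    | succ d ih =>
      rw [hs d, hs (d + 1)]
      exact sup_le_sup le_rfl (iSup_mono fun j => Submodule.map_mono ih)
  have hind (d : ℕ) (S : Submodule ℂ V) (h1 : vac ∈ S) (h2 : ∀ j, ∀ u ∈ W d, L.ad j u ∈ S) :
      W (d + 1) ≤ S := by
    rw [hs]
    refine sup_le ((Submodule.span_singleton_le_iff_mem _ _).mpr h1) (iSup_le fun j => ?_)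
    rintro _ ⟨u, hu, rfl⟩
    exact h2 j u hu
  have ha (d : ℕ) (k : Fin n) : W (d + 1) ≤ (W d).comap (L.a k) := by
    induction d with
    | zero =>
      refine hind 0 _ (by simp [hvac]) fun j u hu => ?_
      have : u = 0 := (Submodule.mem_bot ℂ).mp hu
      simp [this]
    | succ d ih =>
      refine hind (d + 1) _ (by simp [hvac]) fun j u hu => ?_
      rw [Submodule.mem_comap, L.comm]
      refine add_mem (had _ _ _ (ih hu)) ?_
      split_ifs
      exacts [hu, zero_mem _]
  have hn (d : ℕ) : W (d + 1) ≤ (W d).comap (L.num - (d : ℂ) • LinearMap.id) := by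
    induction d with
    | zero =>
      refine hind 0 _ (by simp [hvac, num_apply]) fun j u hu => ?_
      have : u = 0 := (Submodule.mem_bot ℂ).mp hu
      simp [this]
    | succ d ih =>
      refine hind (d + 1) _ ?_ fun j u hu => ?_
      · have : L.num vac = 0 := by simp [hvac, num_apply]
        rw [Submodule.mem_comap]
        simpa [this] using (W (d + 1)).smul_mem _ (hv d)
      · have h := had _ j _ (ih hu)
        rw [Submodule.mem_comap]
        convert h using 1
        simp only [LinearMap.sub_apply, LinearMap.smul_apply, LinearMap.id_apply, num_ad, map_sub,
          map_smul]
        push_cast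
        module
  refine ⟨W, rfl, fun u => ?_, fun d j u hu => ha d j hu, fun d u hu => by simpa using hn d hu⟩
  have htop := hcyc (⨆ d, W d) (Submodule.mem_iSup_of_mem 1 (hv 0)) fun j u hu => by
    rw [Submodule.mem_iSup_of_directed _ hmono.directed_le] at hu
    obtain ⟨d, hd⟩ := hu
    exact Submodule.mem_iSup_of_mem (d + 1) (had d j u hd)
  rw [← Submodule.mem_iSup_of_directed _ hmono.directed_le, htop]
  trivial

lemma gauged_surjective {W : ℕ → Submodule ℂ V} (h0 : W 0 = ⊥) (hW : ∀ u, ∃ d, u ∈ W d)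
    (ha : ∀ d j, ∀ u ∈ W (d + 1), L.a j u ∈ W d)
    (hnum : ∀ d : ℕ, ∀ u ∈ W (d + 1), L.num u - (d : ℂ) • u ∈ W d)
    {z : ℂ} (hz : ¬(0 ≤ z.re ∧ z.im = 0)) (ξ : Ev n) (g : V) :
    ∃ u, L.gauged ξ u - z • u = g := by
  suffices h : ∀ d, W d ≤ LinearMap.range (L.gauged ξ - z • LinearMap.id) by
    obtain ⟨d, hd⟩ := hW g
    exact h d hd
  intro d
  induction d with
  | zero => simp [h0]
  | succ d ih =>
    intro p hp
    set c : ℂ := (d : ℂ) + ((‖ξ‖ ^ 2 : ℝ) : ℂ) - z with hc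
    have hc0 : c ≠ 0 := by
      intro h
      have hzz : z = (((d : ℝ) + ‖ξ‖ ^ 2 : ℝ) : ℂ) := by
        push_cast
        push_cast at hc
        linear_combination -h + hc
      apply hz
      rw [hzz, Complex.ofReal_re, Complex.ofReal_im]
      exact ⟨by positivity, rfl⟩
    have h1 : L.num p - (d : ℂ) • p + (2 * Complex.I) • L.lower ξ p ∈ W d := by
      refine add_mem (hnum d p hp) (Submodule.smul_mem _ _ ?_)
      rw [lower_apply]
      exact Submodule.sum_mem _ fun j _ => Submodule.smul_mem _ _ (ha d j p hp)
    have h2 : c • p ∈ LinearMap.range (L.gauged ξ - z • LinearMap.id) := by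
      have h3 : c • p = (L.gauged ξ - z • LinearMap.id : V →ₗ[ℂ] V) p
          - (L.num p - (d : ℂ) • p + (2 * Complex.I) • L.lower ξ p) := by
        simp only [LinearMap.sub_apply, LinearMap.smul_apply, LinearMap.id_apply, gauged_apply, hc]
        module
      rw [h3]
      exact sub_mem (LinearMap.mem_range_self _ _) (ih h1)
    have := Submodule.smul_mem _ c⁻¹ h2
    rwa [smul_smul, inv_mul_cancel₀ hc0, one_smul] at this

lemma accretive_estimate {ξ : Ev n} {w : ℂ} (hw : w.re ≤ -1) (u : V) :
    ‖L.e u‖ ≤ ‖L.e (L.gauged ξ u - w • u)‖ ∧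
    ∀ j, ‖L.e (L.a j u)‖ ≤ (1 + ‖ξ‖) * ‖L.e (L.gauged ξ u - w • u)‖ := by
  set g := L.gauged ξ u - w • u with hg
  have h1 : ∑ j, ‖L.e (L.a j u - (Complex.I * (ξ j : ℂ)) • u)‖ ^ 2 + ‖L.e u‖ ^ 2
      ≤ ‖L.e u‖ * ‖L.e g‖ := by
    have h2 := (L.shift ξ).re_inner_osc ξ u
    have h3 : (L.shift ξ).osc ξ u = g + w • u := by rw [shift_osc, hg]; abel
    rw [h3, map_add, map_smul, inner_add_right, inner_smul_right, inner_self_eq_norm_sq_to_K] at h2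
    have h4 : (inner ℂ (L.e u) (L.e g)).re ≤ ‖L.e u‖ * ‖L.e g‖ :=
      (Complex.re_le_norm _).trans (norm_inner_le_norm _ _)
    have h5 : (inner ℂ (L.e u) (L.e g)).re + w.re * ‖L.e u‖ ^ 2
        = ∑ j, ‖L.e (L.a j u - (Complex.I * (ξ j : ℂ)) • u)‖ ^ 2 := by
      rw [← Complex.re_mul_ofReal w]
      simpa [shift] using h2
    nlinarith [sq_nonneg ‖L.e u‖]
  have h0 : 0 ≤ ∑ j, ‖L.e (L.a j u - (Complex.I * (ξ j : ℂ)) • u)‖ ^ 2 := by positivity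
  have hu : ‖L.e u‖ ≤ ‖L.e g‖ := by
    by_contra! h
    nlinarith [norm_nonneg (L.e u), norm_nonneg (L.e g)]
  refine ⟨hu, fun j => ?_⟩
  have h2 : ‖L.e (L.a j u - (Complex.I * (ξ j : ℂ)) • u)‖ ≤ ‖L.e g‖ := by
    refine abs_le_of_sq_le_sq' ?_ (norm_nonneg _) |>.2
    have := Finset.single_le_sum (f := fun j => ‖L.e (L.a j u - (Complex.I * (ξ j : ℂ)) • u)‖ ^ 2)
      (fun i _ => sq_nonneg _) (Finset.mem_univ j)
    nlinarith [norm_nonneg (L.e u), norm_nonneg (L.e g)]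
  have h3 : L.e (L.a j u)
      = L.e (L.a j u - (Complex.I * (ξ j : ℂ)) • u) + (Complex.I * (ξ j : ℂ)) • L.e u := by
    rw [map_sub, map_smul, sub_add_cancel]
  have h4 : ‖(Complex.I * (ξ j : ℂ)) • L.e u‖ ≤ ‖ξ‖ * ‖L.e g‖ := by
    rw [norm_smul, norm_mul, Complex.norm_I, one_mul, Complex.norm_real]
    exact mul_le_mul (PiLp.norm_apply_le ξ j) hu (norm_nonneg _) (norm_nonneg _)
  rw [h3]
  refine (norm_add_le _ _).trans ?_
  linarith

lemma accretive_estimate_raise {ξ : Ev n} {w : ℂ} (hw : w.re ≤ -1) (u : V) (j : Fin n) :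
    ‖L.e (L.ad j u + (2 * Complex.I * (ξ j : ℂ)) • u)‖
      ≤ (2 + 3 * ‖ξ‖) * ‖L.e (L.gauged ξ u - w • u)‖ := by
  obtain ⟨h1, h2⟩ := L.accretive_estimate (ξ := ξ) hw u
  have h2 := h2 j
  set g := ‖L.e (L.gauged ξ u - w • u)‖
  have h3 : ‖L.e (L.ad j u)‖ ≤ ‖L.e (L.a j u)‖ + ‖L.e u‖ := by
    refine abs_le_of_sq_le_sq' ?_ (by positivity) |>.2
    rw [norm_ad_sq]
    nlinarith [norm_nonneg (L.e u), norm_nonneg (L.e (L.a j u))]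
  have h4 : ‖(2 * Complex.I * (ξ j : ℂ)) • L.e u‖ ≤ 2 * ‖ξ‖ * g := by
    rw [norm_smul, norm_mul, norm_mul, Complex.norm_I, mul_one, Complex.norm_real, Complex.norm_two]
    have := PiLp.norm_apply_le ξ j
    gcongr
  rw [map_add, map_smul]
  refine (norm_add_le _ _).trans ?_
  linarith

lemma exists_dist_pos {z : ℂ} (hz : ¬(0 ≤ z.re ∧ z.im = 0)) :
    ∃ δ : ℝ, 0 < δ ∧ ∀ r : ℝ, 0 ≤ r → δ ≤ ‖(r : ℂ) - z‖ := by
  by_cases h : z.im = 0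
  · have hre : z.re < 0 := by
      by_contra! h'
      exact hz ⟨h', h⟩
    refine ⟨-z.re, by linarith, fun r hr => ?_⟩
    have := Complex.re_le_norm ((r : ℂ) - z)
    simp only [Complex.sub_re, Complex.ofReal_re] at this
    linarith
  · refine ⟨|z.im|, abs_pos.mpr h, fun r _ => ?_⟩
    simpa using Complex.abs_im_le_norm ((r : ℂ) - z)

/-- Uniform resolvent estimate for bounded `ξ`. -/
lemma bounded_estimate
    (hsurj : ∀ (ξ : Ev n) (w : ℂ), ¬(0 ≤ w.re ∧ w.im = 0) → ∀ g, ∃ u, L.gauged ξ u - w • u = g)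
    (M : ℝ) (m : ℕ) : ∀ z : ℂ, ¬(0 ≤ z.re ∧ z.im = 0) → z.re ≤ m - 1 →
    ∃ C : ℝ, 0 ≤ C ∧ ∀ ξ : Ev n, ‖ξ‖ ≤ M → ∀ u, ‖L.e u‖ ≤ C * ‖L.e (L.gauged ξ u - z • u)‖ := by
  induction m with
  | zero =>
    intro z _ hz
    refine ⟨1, zero_le_one, fun ξ _ u => ?_⟩
    rw [one_mul]
    exact (L.accretive_estimate (by simpa using hz) u).1
  | succ m ih =>
    intro z hD hz
    have hD1 : ¬(0 ≤ (z - 1).re ∧ (z - 1).im = 0) := by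
      rintro ⟨h1, h2⟩
      simp only [Complex.sub_re, Complex.sub_im, Complex.one_re, Complex.one_im, sub_zero] at h1 h2
      exact hD ⟨by linarith, h2⟩
    obtain ⟨C', hC', hbd⟩ := ih (z - 1) hD1 (by
      simp only [Complex.sub_re, Complex.one_re]; push_cast at hz; linarith)
    obtain ⟨δ, hδ, hdist⟩ := exists_dist_pos hD
    set κ : ℝ := max 0 z.re + 1 with hκ
    have hκ0 : 0 ≤ κ := by positivity
    have hw1 : (z - κ).re ≤ -1 := by
      have := le_max_right 0 z.re
      simp only [Complex.sub_re, Complex.ofReal_re]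
      linarith
    have hw2 : (z - κ - 1).re ≤ -1 := by
      simp only [Complex.sub_re, Complex.one_re] at hw1 ⊢
      linarith
    have hDw {w : ℂ} (hw : w.re ≤ -1) : ¬(0 ≤ w.re ∧ w.im = 0) := fun h => by linarith [h.1]
    set B : ℝ := n * ((2 + 3 * |M|) * (κ ^ 2 * (C' * (1 + |M|))))
    refine ⟨(κ ^ 2 + B) / δ + 1 + κ, by positivity, fun ξ hξ u => ?_⟩
    have hξ' : ‖ξ‖ ≤ |M| := hξ.trans (le_abs_self M)
    set g := L.gauged ξ u - z • u with hg
    obtain ⟨h, hh⟩ := hsurj ξ (z - κ) (hDw hw1) g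
    obtain ⟨h2, hh2⟩ := hsurj ξ (z - κ) (hDw hw1) h
    choose p hp using fun j => hsurj ξ (z - 1) hD1 (L.a j h)
    choose f hf using fun j => hsurj ξ (z - κ - 1) (hDw hw2) (((κ ^ 2 : ℝ) : ℂ) • p j)
    set v := u - h - (κ : ℂ) • h2 with hv
    have hTv : L.gauged ξ v - z • v = ((κ ^ 2 : ℝ) : ℂ) • h2 := by
      have e1 : L.gauged ξ h = g + (z - κ) • h := by rw [← hh]; abel
      have e2 : L.gauged ξ h2 = h + (z - κ) • h2 := by
        conv_rhs => enter [1]; rw [← hh2]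
        abel
      have e3 : L.gauged ξ u = g + z • u := by rw [hg]; abel
      rw [hv, map_sub, map_sub, map_smul, e1, e2, e3]
      push_cast
      module
    have hav (j : Fin n) : L.a j v = f j := by
      have e1 : L.gauged ξ v = ((κ ^ 2 : ℝ) : ℂ) • h2 + z • v := by rw [← hTv]; abel
      have e2 : L.gauged ξ h2 = h + (z - κ) • h2 := by
        conv_rhs => enter [1]; rw [← hh2]
        abel
      have e3 : L.gauged ξ (L.a j v) = ((κ ^ 2 : ℝ) : ℂ) • L.a j h2 + (z - 1) • L.a j v := by
        have := L.a_gauged ξ j v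
        rw [e1, map_add, map_smul, map_smul] at this
        rw [← sub_eq_iff_eq_add] at this
        rw [← this]; module
      have e4 : L.gauged ξ (L.a j h2) = L.a j h + (z - κ - 1) • L.a j h2 := by
        have := L.a_gauged ξ j h2
        rw [e2, map_add, map_smul] at this
        rw [← sub_eq_iff_eq_add] at this
        rw [← this]; module
      have e5 : L.gauged ξ (p j) = L.a j h + (z - 1) • p j := by
        rw [← hp]; abel
      have e6 : L.gauged ξ (f j) = ((κ ^ 2 : ℝ) : ℂ) • p j + (z - κ - 1) • f j := by
        rw [← hf]; abel
      set x := L.a j v - f j with hx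
      set y := L.gauged ξ x - (z - κ - 1) • x with hy
      have hy0 : y = 0 := by
        apply L.inj
        have : L.gauged ξ y - (z - 1) • y = 0 := by
          simp only [hy, hx, map_sub, map_smul, map_add, e3, e4, e5, e6]
          module
        have h' := hbd ξ hξ y
        rw [this, map_zero, norm_zero, mul_zero] at h'
        exact norm_le_zero_iff.mp h'
      have hx0 : x = 0 := by
        apply L.inj
        have h' := (L.accretive_estimate (ξ := ξ) hw2 x).1
        rw [← hy, hy0, map_zero, norm_zero] at h'
        exact norm_le_zero_iff.mp h'
      rw [← sub_eq_zero, ← hx, hx0]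
    have hG1 := L.accretive_estimate (ξ := ξ) hw1 h
    have hG2 := (L.accretive_estimate (ξ := ξ) hw1 h2).1
    rw [hh] at hG1
    rw [hh2] at hG2
    set G := ‖L.e g‖
    have hcf (j : Fin n) : ‖L.e (L.ad j (f j) + (2 * Complex.I * (ξ j : ℂ)) • f j)‖
        ≤ (2 + 3 * |M|) * (κ ^ 2 * (C' * (1 + |M|))) * G := by
      have h1 := L.accretive_estimate_raise (ξ := ξ) hw2 (f j) j
      have h3 := hbd ξ hξ (p j)
      rw [hf, map_smul, norm_smul, Complex.norm_real, Real.norm_of_nonneg (by positivity)] at h1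
      rw [hp] at h3
      calc _ ≤ (2 + 3 * ‖ξ‖) * (κ ^ 2 * ‖L.e (p j)‖) := h1
        _ ≤ (2 + 3 * |M|) * (κ ^ 2 * (C' * ((1 + |M|) * G))) := by
          gcongr
          refine h3.trans ?_
          gcongr
          refine (hG1.2 j).trans ?_
          gcongr
        _ = _ := by ring
    have hsv : (((‖ξ‖ ^ 2 : ℝ) : ℂ) - z) • L.e v = ((κ ^ 2 : ℝ) : ℂ) • L.e h2
        - ∑ j, L.e (L.ad j (f j) + (2 * Complex.I * (ξ j : ℂ)) • f j) := by
      rw [← map_sum, ← map_smul, ← map_smul, ← map_sub]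
      congr 1
      rw [← hTv, gauged_apply, num_apply, lower_apply]
      simp only [hav, Finset.sum_add_distrib, Finset.smul_sum, smul_smul]
      module
    have hvn : ‖L.e v‖ ≤ (κ ^ 2 + B) / δ * G := by
      have h1 : δ * ‖L.e v‖ ≤ (κ ^ 2 + B) * G := by
        calc δ * ‖L.e v‖ ≤ ‖((‖ξ‖ ^ 2 : ℝ) : ℂ) - z‖ * ‖L.e v‖ := by
              gcongr
              exact hdist _ (by positivity)
          _ = ‖((κ ^ 2 : ℝ) : ℂ) • L.e h2
                - ∑ j, L.e (L.ad j (f j) + (2 * Complex.I * (ξ j : ℂ)) • f j)‖ := by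
              rw [← norm_smul, hsv]
          _ ≤ κ ^ 2 * G + ∑ _j : Fin n, (2 + 3 * |M|) * (κ ^ 2 * (C' * (1 + |M|))) * G := by
              refine (norm_sub_le _ _).trans (add_le_add ?_ ?_)
              · rw [norm_smul, Complex.norm_real, Real.norm_of_nonneg (by positivity)]
                gcongr
                exact hG2.trans hG1.1
              · exact (norm_sum_le _ _).trans (Finset.sum_le_sum fun j _ => hcf j)
          _ = _ := by
              rw [Finset.sum_const, Finset.card_univ, Fintype.card_fin, nsmul_eq_mul]
              ring
      rw [div_mul_eq_mul_div, le_div_iff₀ hδ]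
      linarith
    have hu : L.e u = L.e v + L.e h + (κ : ℂ) • L.e h2 := by
      rw [hv]
      simp only [map_sub, map_smul]
      abel
    rw [hu]
    refine (norm_add₃_le).trans ?_
    rw [norm_smul, Complex.norm_real, Real.norm_of_nonneg hκ0]
    have : κ * ‖L.e h2‖ ≤ κ * G := by
      gcongr
      exact hG2.trans hG1.1
    linarith [hG1.1]

/-- Resolvent estimate uniform in `ξ`. -/
lemma uniform_estimate
    (hsurj : ∀ (ξ : Ev n) (w : ℂ), ¬(0 ≤ w.re ∧ w.im = 0) → ∀ g, ∃ u, L.gauged ξ u - w • u = g)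
    {z : ℂ} (hz : ¬(0 ≤ z.re ∧ z.im = 0)) :
    ∃ C : ℝ, 0 ≤ C ∧ ∀ (ξ : Ev n) (u : V), ‖L.e u‖ ≤ C * ‖L.e (L.gauged ξ u - z • u)‖ := by
  obtain ⟨M, -, hM⟩ := le_norm_osc (n := n) (V := V) (H := H) (‖z‖ + 1)
    (by linarith [norm_nonneg z])
  obtain ⟨m, hm⟩ := exists_nat_ge (z.re + 1)
  obtain ⟨C, hC, hbd⟩ := L.bounded_estimate hsurj M m z hz (by linarith)
  refine ⟨max C 1, by positivity, fun ξ u => ?_⟩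
  rcases le_total ‖ξ‖ M with h | h
  · exact (hbd ξ h u).trans (by gcongr; exact le_max_left _ _)
  · have h1 : (‖z‖ + 1) * ‖L.e u‖ ≤ ‖L.e (L.gauged ξ u)‖ := by
      rw [← shift_osc]
      exact hM (L.shift ξ) ξ h u
    have h2 : ‖L.e (L.gauged ξ u)‖ ≤ ‖L.e (L.gauged ξ u - z • u)‖ + ‖z‖ * ‖L.e u‖ := by
      rw [← norm_smul, ← map_smul]
      refine le_trans (le_of_eq ?_) (norm_add_le _ _)
      rw [← map_add, sub_add_cancel]
    calc ‖L.e u‖ ≤ 1 * ‖L.e (L.gauged ξ u - z • u)‖ := by linarith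
      _ ≤ _ := by gcongr; exact le_max_right _ _

end CCRSystem

end CCR

section Gaussian

open SchwartzMap

lemma norm_iteratedFDeriv_cexp (i : ℕ) (w : ℂ) :
    ‖iteratedFDeriv ℝ i Complex.exp w‖ = ‖Complex.exp w‖ := by
  have h : ContDiffAt ℂ i Complex.exp w := Complex.contDiff_exp.contDiffAt
  rw [← h.restrictScalars_iteratedFDeriv (𝕜 := ℝ), Function.comp_apply,
    ContinuousMultilinearMap.norm_restrictScalars, norm_iteratedFDeriv_eq_norm_iteratedDeriv,
    iteratedDeriv_eq_iterate, Complex.iter_deriv_exp]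

/-- The exponent of the modulated Gaussian. -/
def gaussPhase {n : ℕ} (ξ v : Ev n) : ℂ :=
  -((‖v‖ ^ 2 / 4 : ℝ) : ℂ) - Complex.I * ((∑ j, v j * ξ j : ℝ) : ℂ)

lemma gaussPhase_re {n : ℕ} (ξ v : Ev n) : (gaussPhase ξ v).re = -(‖v‖ ^ 2 / 4) := by
  rw [gaussPhase, Complex.sub_re, Complex.neg_re, Complex.ofReal_re, Complex.mul_re,
    Complex.ofReal_im, Complex.I_re]
  ring

lemma hasTemperateGrowth_coord {n : ℕ} (j : Fin n) :
    (fun v : Ev n => (v j : ℂ)).HasTemperateGrowth :=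
  (Complex.ofRealCLM ∘L (EuclideanSpace.proj j : Ev n →L[ℝ] ℝ)).hasTemperateGrowth

lemma hasTemperateGrowth_gaussPhase {n : ℕ} (ξ : Ev n) :
    (gaussPhase ξ).HasTemperateGrowth := by
  have h1 : (fun v : Ev n => ((‖v‖ ^ 2 : ℝ) : ℂ)).HasTemperateGrowth :=
    Function.HasTemperateGrowth.comp Function.Complex.hasTemperateGrowth_ofReal
      (Function.hasTemperateGrowth_norm_sq (Ev n))
  have h2 : (fun v : Ev n => ∑ j, (v j : ℂ) * (ξ j : ℂ)).HasTemperateGrowth :=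
    Function.HasTemperateGrowth.sum fun j _ =>
      (hasTemperateGrowth_coord j).mul (Function.HasTemperateGrowth.const _)
  have h3 := ((Function.HasTemperateGrowth.const (-(1 / 4 : ℂ))).mul h1).sub
    ((Function.HasTemperateGrowth.const Complex.I).mul h2)
  have h4 : gaussPhase ξ = (fun _ => -(1 / 4 : ℂ)) * (fun v : Ev n => ((‖v‖ ^ 2 : ℝ) : ℂ))
      - (fun _ => Complex.I) * fun v : Ev n => ∑ j, (v j : ℂ) * (ξ j : ℂ) := by
    funext v
    simp only [gaussPhase, Pi.sub_apply, Pi.mul_apply]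
    push_cast
    ring
  rw [h4]
  exact h3

lemma one_add_pow_mul_exp_le (N : ℕ) {r : ℝ} (hr : 0 ≤ r) :
    (1 + r) ^ N * Real.exp (-(r ^ 2 / 4)) ≤ N.factorial * Real.exp 2 := by
  have h1 : (1 + r) ^ N ≤ N.factorial * Real.exp (1 + r) := by
    have := Real.pow_div_factorial_le_exp (1 + r) (by positivity) N
    rwa [div_le_iff₀' (by positivity)] at this
  calc (1 + r) ^ N * Real.exp (-(r ^ 2 / 4))
      ≤ N.factorial * Real.exp (1 + r) * Real.exp (-(r ^ 2 / 4)) := by gcongr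
    _ = N.factorial * Real.exp (1 + r - r ^ 2 / 4) := by
      rw [mul_assoc, ← Real.exp_add]; ring_nf
    _ ≤ _ := by
      gcongr
      nlinarith [sq_nonneg (r - 2)]

/-- The modulated Gaussian `exp (-‖v‖ ^ 2 / 4 - i ξ · v)`. -/
def modGauss {n : ℕ} (ξ : Ev n) : 𝓢(Ev n, ℂ) where
  toFun v := Complex.exp (gaussPhase ξ v)
  smooth' := Complex.contDiff_exp.comp (hasTemperateGrowth_gaussPhase ξ).1
  decay' k m := by
    obtain ⟨l, C, hC, hbd⟩ := (hasTemperateGrowth_gaussPhase ξ).norm_iteratedFDeriv_le_uniform m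
    refine ⟨m.factorial * (C + 1) ^ m * ((k + l * m).factorial * Real.exp 2), fun v => ?_⟩
    have hD : ∀ i, 1 ≤ i → i ≤ m →
        ‖iteratedFDeriv ℝ i (gaussPhase ξ) v‖ ≤ ((C + 1) * (1 + ‖v‖) ^ l) ^ i := by
      intro i hi him
      have h1 : 1 ≤ (C + 1) * (1 + ‖v‖) ^ l :=
        one_le_mul_of_one_le_of_one_le (by linarith)
          (one_le_pow₀ (by linarith [norm_nonneg v]))
      refine (hbd i him v).trans (le_trans ?_ (le_self_pow₀ h1 (by omega)))
      gcongr
      linarith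
    have h := norm_iteratedFDeriv_comp_le (𝕜 := ℝ) (N := m) (Complex.contDiff_exp (𝕜 := ℝ))
      ((hasTemperateGrowth_gaussPhase ξ).1.of_le (by exact_mod_cast le_top)) le_rfl v
      (C := ‖Complex.exp (gaussPhase ξ v)‖)
      (fun i _ => (norm_iteratedFDeriv_cexp i _).le) hD
    rw [Complex.norm_exp, gaussPhase_re] at h
    calc ‖v‖ ^ k * ‖iteratedFDeriv ℝ m (fun v => Complex.exp (gaussPhase ξ v)) v‖
        ≤ (1 + ‖v‖) ^ k * (m.factorial * Real.exp (-(‖v‖ ^ 2 / 4))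
            * ((C + 1) * (1 + ‖v‖) ^ l) ^ m) := by
          gcongr
          · linarith
          · exact h
      _ = m.factorial * (C + 1) ^ m
            * ((1 + ‖v‖) ^ (k + l * m) * Real.exp (-(‖v‖ ^ 2 / 4))) := by
          rw [mul_pow, pow_add, pow_mul]; ring
      _ ≤ _ := by
          exact mul_le_mul_of_nonneg_left (one_add_pow_mul_exp_le _ (norm_nonneg v)) (by positivity)

lemma modGauss_apply {n : ℕ} (ξ v : Ev n) : modGauss ξ v = Complex.exp (gaussPhase ξ v) := rfl

/-- Evaluation of a complex polynomial at a real point. -/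
def polyEval {n : ℕ} (p : MvPolynomial (Fin n) ℂ) (v : Ev n) : ℂ :=
  MvPolynomial.eval (fun j => (v j : ℂ)) p

lemma hasTemperateGrowth_polyEval {n : ℕ} (p : MvPolynomial (Fin n) ℂ) :
    (polyEval p).HasTemperateGrowth := by
  induction p using MvPolynomial.induction_on with
  | C a =>
    have : polyEval (MvPolynomial.C a) = fun _ : Ev n => a := by funext; simp [polyEval]
    rw [this]
    exact Function.HasTemperateGrowth.const a
  | add p q hp hq =>
    have : polyEval (p + q) = polyEval p + polyEval q := by funext; simp [polyEval]
    rw [this]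
    exact hp.add hq
  | mul_X p j hp =>
    have : polyEval (p * MvPolynomial.X j) = polyEval p * fun v : Ev n => (v j : ℂ) := by
      funext; simp [polyEval]
    rw [this]
    exact hp.mul (hasTemperateGrowth_coord j)

lemma hasFDerivAt_coord {n : ℕ} (j : Fin n) (v : Ev n) :
    HasFDerivAt (fun v : Ev n => (v j : ℂ))
      (Complex.ofRealCLM ∘L (EuclideanSpace.proj j : Ev n →L[ℝ] ℝ)) v :=
  (Complex.ofRealCLM ∘L (EuclideanSpace.proj j : Ev n →L[ℝ] ℝ)).hasFDerivAt

lemma fderiv_polyEval {n : ℕ} (p : MvPolynomial (Fin n) ℂ) (j : Fin n) (v : Ev n) :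
    fderiv ℝ (polyEval p) v (EuclideanSpace.single j 1) = polyEval (MvPolynomial.pderiv j p) v := by
  have hd (p : MvPolynomial (Fin n) ℂ) : DifferentiableAt ℝ (polyEval p) v :=
    ((hasTemperateGrowth_polyEval p).1.differentiable (by simp)).differentiableAt
  induction p using MvPolynomial.induction_on with
  | C a =>
    have : polyEval (MvPolynomial.C a) = fun _ : Ev n => a := by funext; simp [polyEval]
    rw [this]
    simp [polyEval]
  | add p q hp hq =>
    have : polyEval (p + q) = polyEval p + polyEval q := by funext; simp [polyEval]
    rw [this, fderiv_add (hd p) (hd q), add_apply, hp, hq]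
    simp [polyEval]
  | mul_X p k hp =>
    have : polyEval (p * MvPolynomial.X k) = fun v : Ev n => polyEval p v * (v k : ℂ) := by
      funext; simp [polyEval]
    rw [this, fderiv_fun_mul (hd p) (hasFDerivAt_coord k v).differentiableAt,
      (hasFDerivAt_coord k v).fderiv, add_apply,
      smul_apply, smul_apply, hp]
    simp [polyEval, Derivation.leibniz, MvPolynomial.pderiv_X, Pi.single_apply]
    split_ifs <;> simp [*]

/-- Polynomials times the modulated Gaussian. -/
def hermiteFun {n : ℕ} (ξ : Ev n) : MvPolynomial (Fin n) ℂ →ₗ[ℂ] 𝓢(Ev n, ℂ) where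
  toFun p := smulLeftCLM ℂ (polyEval p) (modGauss ξ)
  map_add' p q := by
    ext v
    simp [smulLeftCLM_apply_apply (hasTemperateGrowth_polyEval _), polyEval, add_mul]
  map_smul' c p := by
    ext v
    simp [smulLeftCLM_apply_apply (hasTemperateGrowth_polyEval _), polyEval, mul_assoc]

lemma hermiteFun_apply {n : ℕ} (ξ : Ev n) (p : MvPolynomial (Fin n) ℂ) (v : Ev n) :
    hermiteFun ξ p v = polyEval p v * Complex.exp (gaussPhase ξ v) :=
  smulLeftCLM_apply_apply (hasTemperateGrowth_polyEval p) _ v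

lemma fderiv_gaussPhase {n : ℕ} (ξ v : Ev n) (j : Fin n) :
    fderiv ℝ (gaussPhase ξ) v (EuclideanSpace.single j 1)
      = -((v j : ℂ) / 2) - Complex.I * (ξ j : ℂ) := by
  have h1 : HasFDerivAt (fun v : Ev n => ((‖v‖ ^ 2 / 4 : ℝ) : ℂ))
      (Complex.ofRealCLM ∘L ((4⁻¹ : ℝ) • (2 • innerSL ℝ v))) v := by
    refine Complex.ofRealCLM.hasFDerivAt.comp v ?_
    have := (hasStrictFDerivAt_norm_sq v).hasFDerivAt.const_mul (4⁻¹ : ℝ)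
    simp_rw [← div_eq_inv_mul] at this
    exact this
  have h2 : HasFDerivAt (fun v : Ev n => ((∑ j, v j * ξ j : ℝ) : ℂ))
      (Complex.ofRealCLM ∘L (∑ j, (ξ j) • (EuclideanSpace.proj j : Ev n →L[ℝ] ℝ))) v := by
    refine Complex.ofRealCLM.hasFDerivAt.comp v ?_
    have h (j : Fin n) : HasFDerivAt (fun v : Ev n => v j * ξ j)
        ((ξ j) • (EuclideanSpace.proj j : Ev n →L[ℝ] ℝ)) v :=
      (EuclideanSpace.proj j : Ev n →L[ℝ] ℝ).hasFDerivAt.mul_const (ξ j)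
    exact HasFDerivAt.fun_sum (u := Finset.univ) fun j _ => h j
  have h3 : HasFDerivAt (gaussPhase ξ) _ v := h1.neg.sub (h2.const_mul Complex.I)
  rw [h3.fderiv]
  simp [EuclideanSpace.inner_single_right]
  ring

lemma lineDeriv_hermiteFun {n : ℕ} (ξ : Ev n) (p : MvPolynomial (Fin n) ℂ) (j : Fin n) (v : Ev n) :
    fderiv ℝ (hermiteFun ξ p) v (EuclideanSpace.single j 1)
      = hermiteFun ξ (MvPolynomial.pderiv j p) v
        - ((v j : ℂ) / 2 + Complex.I * (ξ j : ℂ)) * hermiteFun ξ p v := by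
  have h0 : (hermiteFun ξ p : Ev n → ℂ)
      = fun v => polyEval p v * Complex.exp (gaussPhase ξ v) := by
    funext v; exact hermiteFun_apply ξ p v
  have hd : DifferentiableAt ℝ (gaussPhase ξ) v :=
    ((hasTemperateGrowth_gaussPhase ξ).1.differentiable (by simp)).differentiableAt
  have hp : DifferentiableAt ℝ (polyEval p) v :=
    ((hasTemperateGrowth_polyEval p).1.differentiable (by simp)).differentiableAt
  rw [h0, fderiv_fun_mul hp hd.cexp, add_apply,
    smul_apply, smul_apply, fderiv_polyEval,
    hd.hasFDerivAt.cexp.fderiv, smul_apply, fderiv_gaussPhase,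
    hermiteFun_apply]
  simp only [smul_eq_mul]
  ring

end Gaussian

section WeakFormulation

open SchwartzMap

lemma integral_mul_eq_inner {α : Type*} [MeasurableSpace α] {μ : Measure α} (f g : Lp ℂ 2 μ) :
    ∫ x, f x * g x ∂μ = inner ℂ (star f) g := by
  rw [L2.inner_def]
  refine integral_congr_ae ?_
  filter_upwards [Lp.coeFn_star f] with x hx
  rw [hx]
  simp [mul_comm]

lemma norm_star_Lp {α : Type*} [MeasurableSpace α] {μ : Measure α} (f : Lp ℂ 2 μ) :
    ‖star f‖ = ‖f‖ := by
  refine le_antisymm (Lp.norm_le_norm_of_ae_le ?_) (Lp.norm_le_norm_of_ae_le ?_) <;>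
  · filter_upwards [Lp.coeFn_star f] with x hx
    simp [hx]

lemma exists_resolvent {V H : Type*} [AddCommGroup V] [Module ℂ V] [NormedAddCommGroup H]
    [NormedSpace ℂ H] [CompleteSpace H] (e : V →ₗ[ℂ] H) (T : V →ₗ[ℂ] V) (he : DenseRange e)
    (hT : Function.Surjective T) {C : ℝ} (hC : 0 ≤ C) (h : ∀ u, ‖e u‖ ≤ C * ‖e (T u)‖) :
    ∃ R : H →L[ℂ] H, (∀ u, R (e (T u)) = e u) ∧ ‖R‖ ≤ C := by
  have hd : DenseRange (e ∘ₗ T) := by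
    rw [LinearMap.coe_comp, DenseRange, Set.range_comp, hT.range_eq, Set.image_univ]
    exact he
  exact ⟨e.extendOfNorm (e ∘ₗ T), fun u => LinearMap.extendOfNorm_eq hd ⟨C, h⟩ u,
    LinearMap.opNorm_extendOfNorm_le hd hC h⟩

variable {E : Type*} [NormedAddCommGroup E] [NormedSpace ℝ E] [FiniteDimensional ℝ E]

lemma exists_cutoff (E : Type*) [NormedAddCommGroup E] [NormedSpace ℝ E]
    [FiniteDimensional ℝ E] : ∃ h : E → ℂ, ContDiff ℝ (⊤ : ℕ∞) h ∧ (∀ x, ‖x‖ < 1 → h x = 0) ∧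
      HasCompactSupport (fun x => 1 - h x) ∧ ∀ i, ∃ M, ∀ x, ‖iteratedFDeriv ℝ i h x‖ ≤ M := by
  let b : ContDiffBump (0 : E) := ⟨1, 2, by norm_num, by norm_num⟩
  let χ : E → ℂ := fun x => (b x : ℂ)
  have hχ : ContDiff ℝ (⊤ : ℕ∞) χ := Complex.ofRealCLM.contDiff.comp b.contDiff
  have hs : HasCompactSupport χ := b.hasCompactSupport.comp_left (g := Complex.ofReal) rfl
  refine ⟨fun x => 1 - χ x, contDiff_const.sub hχ, fun x hx => ?_, ?_, fun i => ?_⟩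
  · have : b x = 1 := b.one_of_mem_closedBall (by simpa [b] using hx.le)
    simp [χ, this]
  · simpa using hs
  · obtain ⟨M, hM⟩ := (hs.iteratedFDeriv (𝕜 := ℝ) i).exists_bound_of_continuous
      (hχ.continuous_iteratedFDeriv (by exact_mod_cast le_top))
    refine ⟨1 + M, fun x => ?_⟩
    have h1 : iteratedFDeriv ℝ i (fun x => 1 - χ x) x
        = iteratedFDeriv ℝ i (fun _ : E => (1 : ℂ)) x - iteratedFDeriv ℝ i χ x :=
      iteratedFDeriv_sub_apply contDiffAt_const (hχ.of_le (by exact_mod_cast le_top)).contDiffAt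
    rw [h1]
    refine (norm_sub_le _ _).trans (add_le_add ?_ (hM x))
    rcases eq_or_ne i 0 with rfl | hi
    · simp
    · simp [iteratedFDeriv_const_of_ne hi]

/-- Compactly supported smooth functions are dense in the Schwartz space. -/
lemma dense_hasCompactSupport :
    Dense {φ : 𝓢(E, ℂ) | HasCompactSupport φ} := by
  obtain ⟨h, h_smooth, h_zero, h_supp, h_bd⟩ := exists_cutoff E
  choose M hM using h_bd
  have hM0 (i : ℕ) : 0 ≤ M i := (norm_nonneg _).trans (hM i 0)
  intro φ
  let g (R : ℝ) (x : E) : ℂ := h (R⁻¹ • x)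
  have hg (R : ℝ) : ContDiff ℝ (⊤ : ℕ∞) (g R) := h_smooth.comp (contDiff_const_smul _)
  have hgb {R : ℝ} (hR : 1 ≤ R) (i : ℕ) (x : E) :
      ‖iteratedFDeriv ℝ i (g R) x‖ ≤ M i * (‖x‖ / R) := by
    rcases lt_or_ge ‖x‖ R with hx | hx
    · have : g R =ᶠ[𝓝 x] fun _ => 0 := by
        filter_upwards [continuous_norm.continuousAt.eventually_lt_const hx] with y hy
        refine h_zero _ ?_
        rw [norm_smul, norm_inv, Real.norm_of_nonneg (by linarith)]
        rw [inv_mul_lt_iff₀ (by linarith)]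
        simpa using hy
      have h0 : iteratedFDeriv ℝ i (g R) x = 0 := by
        rw [(this.iteratedFDeriv ℝ i).eq_of_nhds]
        simp
      rw [h0, norm_zero]
      have := hM0 i
      positivity
    · have h1 : 1 ≤ ‖x‖ / R := (one_le_div (by linarith)).2 hx
      have h2 : ‖iteratedFDeriv ℝ i (g R) x‖ ≤ M i := by
        simp only [g]
        rw [iteratedFDeriv_comp_const_smul R⁻¹ (h_smooth.of_le (by exact_mod_cast le_top)),
          norm_smul, norm_pow, norm_inv, Real.norm_of_nonneg (by linarith)]
        calc (R⁻¹) ^ i * ‖iteratedFDeriv ℝ i h (R⁻¹ • x)‖ ≤ 1 * M i := by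
              gcongr
              · exact pow_le_one₀ (by positivity) (inv_le_one_of_one_le₀ hR)
              · exact hM i _
          _ = M i := one_mul _
      exact h2.trans (le_mul_of_one_le_right (hM0 i) h1)
  have hcs {R : ℝ} (hR : 1 ≤ R) : HasCompactSupport fun x => (1 - g R x) * φ x := by
    refine HasCompactSupport.mul_right ?_
    exact h_supp.comp_homeomorph (Homeomorph.smulOfNeZero R⁻¹ (by positivity))
  have hsm (R : ℝ) : ContDiff ℝ (⊤ : ℕ∞) fun x => (1 - g R x) * φ x :=
    (contDiff_const.sub (hg R)).mul (φ.smooth _)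
  let ψ (R : ℝ) : 𝓢(E, ℂ) :=
    if hR : 1 ≤ R then (hcs hR).toSchwartzMap (hsm R) else 0
  have hψ {R : ℝ} (hR : 1 ≤ R) (x : E) : ψ R x = (1 - g R x) * φ x := by
    simp only [ψ, dif_pos hR]
    rfl
  refine mem_closure_of_tendsto (f := ψ) (b := atTop) ?_ ?_
  · rw [(schwartz_withSeminorms ℂ E ℂ).tendsto_nhds]
    rintro ⟨k, m⟩ ε hε
    let K := ∑ i ∈ Finset.range (m + 1),
      (m.choose i : ℝ) * M i * SchwartzMap.seminorm ℂ (k + 1) (m - i) φ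
    have hK : 0 ≤ K := Finset.sum_nonneg fun i _ => by
      have := hM0 i
      positivity
    have hb {R : ℝ} (hR : 1 ≤ R) : SchwartzMap.seminorm ℂ k m (ψ R - φ) ≤ K / R := by
      refine seminorm_le_bound ℂ k m _ (by positivity) fun x => ?_
      have h1 : (ψ R - φ : 𝓢(E, ℂ)) = fun x => -(g R x * φ x) := by
        funext x
        rw [sub_apply, hψ hR]
        ring
      rw [h1, show (fun x => -(g R x * φ x)) = -(fun x => g R x * φ x) from rfl,
        iteratedFDeriv_neg_apply, norm_neg]
      have h2 := norm_iteratedFDeriv_mul_le (𝕜 := ℝ) (hg R) (φ.smooth ⊤) x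
        (n := m) (by exact_mod_cast le_top)
      calc ‖x‖ ^ k * ‖iteratedFDeriv ℝ m (fun x => g R x * φ x) x‖
          ≤ ‖x‖ ^ k * ∑ i ∈ Finset.range (m + 1), (m.choose i : ℝ)
              * ‖iteratedFDeriv ℝ i (g R) x‖ * ‖iteratedFDeriv ℝ (m - i) φ x‖ := by gcongr
        _ ≤ ‖x‖ ^ k * ∑ i ∈ Finset.range (m + 1), (m.choose i : ℝ)
              * (M i * (‖x‖ / R)) * ‖iteratedFDeriv ℝ (m - i) φ x‖ := by
            gcongr with i hi
            exact hgb hR i x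
        _ = (∑ i ∈ Finset.range (m + 1), (m.choose i : ℝ) * M i
              * (‖x‖ ^ (k + 1) * ‖iteratedFDeriv ℝ (m - i) φ x‖)) / R := by
            rw [Finset.mul_sum, Finset.sum_div]
            refine Finset.sum_congr rfl fun i _ => ?_
            ring
        _ ≤ K / R := by
            simp only [K]
            gcongr with i hi
            · exact mul_nonneg (by positivity) (hM0 i)
            · exact le_seminorm ℂ (k + 1) (m - i) φ x
    have hlim : Tendsto (fun R : ℝ => K / R) atTop (𝓝 0) := tendsto_id.const_div_atTop K
    filter_upwards [hlim.eventually_lt_const hε, eventually_ge_atTop 1] with R h1 h2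
    exact (hb h2).trans_lt h1
  · filter_upwards [eventually_ge_atTop 1] with R hR
    have : (ψ R : E → ℂ) = fun x => (1 - g R x) * φ x := funext (hψ hR)
    change HasCompactSupport (ψ R)
    rw [this]
    exact hcs hR

section SchwartzPair

variable {E : Type*} [NormedAddCommGroup E] [NormedSpace ℝ E]
  [MeasurableSpace E] [BorelSpace E] {μ : Measure E} [μ.HasTemperateGrowth]

lemma integral_mul_schwartz (f : Lp ℂ 2 μ) (φ : 𝓢(E, ℂ)) :
    ∫ x, f x * φ x ∂μ = inner ℂ (star f) (φ.toLp 2 μ) := by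
  rw [← integral_mul_eq_inner]
  refine integral_congr_ae ?_
  filter_upwards [φ.coeFn_toLp 2 μ] with x hx
  rw [hx]

lemma integrable_mul_schwartz (f g : 𝓢(E, ℂ)) : Integrable (fun x => f x * g x) μ :=
  (f.memLp 2 μ).integrable_mul (g.memLp 2 μ)

lemma integral_lp_mul_schwartz (f : Lp ℂ 2 μ) (φ : 𝓢(E, ℂ)) :
    ∫ x, f x * φ x ∂μ = inner ℂ (star (φ.toLp 2 μ)) f := by
  rw [← integral_mul_eq_inner]
  refine integral_congr_ae ?_
  filter_upwards [φ.coeFn_toLp 2 μ] with x hx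
  rw [hx, mul_comm]

lemma integral_toLp_mul (f φ : 𝓢(E, ℂ)) :
    ∫ x, f.toLp 2 μ x * φ x ∂μ = ∫ x, f x * φ x ∂μ := by
  refine integral_congr_ae ?_
  filter_upwards [f.coeFn_toLp 2 μ] with x hx
  rw [hx]

/-- The bilinear pairing of Schwartz functions. -/
def schwartzPair (μ : Measure E) [μ.HasTemperateGrowth] : 𝓢(E, ℂ) →ₗ[ℂ] 𝓢(E, ℂ) →ₗ[ℂ] ℂ :=
  LinearMap.mk₂ ℂ (fun f g => ∫ x, f x * g x ∂μ)
    (fun f g h => by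
      rw [← integral_add (integrable_mul_schwartz f h) (integrable_mul_schwartz g h)]
      simp [add_mul])
    (fun c f g => by
      rw [smul_eq_mul, ← integral_const_mul]
      simp [mul_assoc])
    (fun f g h => by
      rw [← integral_add (integrable_mul_schwartz f g) (integrable_mul_schwartz f h)]
      simp [mul_add])
    (fun c f g => by
      rw [smul_eq_mul, ← integral_const_mul]
      simp [mul_left_comm])

lemma schwartzPair_apply (f g : 𝓢(E, ℂ)) : schwartzPair μ f g = ∫ x, f x * g x ∂μ := rfl

lemma schwartzPair_smulLeft {a : E → ℂ} (ha : a.HasTemperateGrowth) (f g : 𝓢(E, ℂ)) :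
    schwartzPair μ f (smulLeftCLM ℂ a g) = schwartzPair μ (smulLeftCLM ℂ a f) g := by
  simp only [schwartzPair_apply, smulLeftCLM_apply_apply ha, smul_eq_mul]
  refine integral_congr_ae (Eventually.of_forall fun x => ?_)
  simp only
  ring

lemma eq_of_forall_integral_mul_eq {V : Type*} [AddCommGroup V] [Module ℂ V]
    {e : V →ₗ[ℂ] 𝓢(E, ℂ)} (he : DenseRange fun u => (e u).toLp 2 μ) (f w : Lp ℂ 2 μ)
    (h : ∀ u, ∫ x, f x * e u x ∂μ = ∫ x, w x * e u x ∂μ) : f = w := by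
  simp only [integral_mul_schwartz] at h
  have h1 : (fun g => inner ℂ (star f) g) = fun g => inner ℂ (star w) g :=
    (continuous_const.inner continuous_id).ext_on he (continuous_const.inner continuous_id)
      (by rintro _ ⟨u, rfl⟩; exact h u)
  have h2 : star f = star w := ext_inner_right ℂ fun g => congrFun h1 g
  exact star_injective h2

end SchwartzPair

variable [MeasurableSpace E] [BorelSpace E] {μ : Measure E} [μ.HasTemperateGrowth]

lemma schwartzPair_lineDeriv [μ.IsAddHaarMeasure] (f g : 𝓢(E, ℂ)) (v : E) :
    schwartzPair μ f (LineDeriv.lineDerivOp v g) = -schwartzPair μ (LineDeriv.lineDerivOp v f) g :=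
  integral_mul_lineDerivOp_right_eq_neg_left f g v

/-- A weak equation that holds for compactly supported smooth test functions holds for Schwartz
test functions. -/
lemma weak_eq_schwartz (Q : 𝓢(E, ℂ) →L[ℂ] 𝓢(E, ℂ)) (f w : Lp ℂ 2 μ)
    (h : ∀ φ : 𝓢(E, ℂ), HasCompactSupport φ → ∫ x, f x * Q φ x ∂μ = ∫ x, w x * φ x ∂μ)
    (φ : 𝓢(E, ℂ)) : ∫ x, f x * Q φ x ∂μ = ∫ x, w x * φ x ∂μ := by
  simp only [integral_mul_schwartz] at h ⊢
  have h1 : Continuous fun φ : 𝓢(E, ℂ) => inner ℂ (star f) ((Q φ).toLp 2 μ) :=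
    continuous_const.inner (((toLpCLM ℂ ℂ 2 μ).comp Q).continuous)
  have h2 : Continuous fun φ : 𝓢(E, ℂ) => inner ℂ (star w) (φ.toLp 2 μ) :=
    continuous_const.inner ((toLpCLM ℂ ℂ 2 μ).continuous)
  exact congrFun (h1.ext_on dense_hasCompactSupport h2 fun φ hφ => h φ hφ) φ

end WeakFormulation

section Density

open SchwartzMap

variable {n : ℕ}

/-- An integrable function with vanishing Fourier transform vanishes almost everywhere. -/
lemma ae_eq_zero_of_fourier_eq_zero {F : Ev n → ℂ} (hF : Integrable F)
    (h : ∀ w, FourierTransform.fourier F w = 0) : ∀ᵐ v, F v = 0 := by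
  refine ae_eq_zero_of_integral_contDiff_smul_eq_zero hF.locallyIntegrable fun g hg hgs => ?_
  have hs : HasCompactSupport fun v => (g v : ℂ) := hgs.comp_left (g := Complex.ofReal) rfl
  let φ : 𝓢(Ev n, ℂ) := hs.toSchwartzMap (Complex.ofRealCLM.contDiff.comp hg)
  let ψ : 𝓢(Ev n, ℂ) := FourierTransformInv.fourierInv φ
  have h1 : FourierTransform.fourier ψ = φ := FourierTransform.fourier_fourierInv_eq φ
  have h2 := VectorFourier.integral_fourierIntegral_smul_eq_flip (μ := volume) (ν := volume)
    (e := Real.fourierChar) (L := innerₗ (Ev n)) (f := F) (g := ψ)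
    Real.continuous_fourierChar continuous_inner hF ψ.integrable
  have h3 : ∀ w, VectorFourier.fourierIntegral Real.fourierChar volume (innerₗ (Ev n)) F w = 0 := h
  have h4 : ∀ w, VectorFourier.fourierIntegral Real.fourierChar volume (innerₗ (Ev n)).flip ψ w
      = (g w : ℂ) := by
    intro w
    rw [flip_innerₗ]
    change FourierTransform.fourier (ψ : Ev n → ℂ) w = φ w
    rw [← SchwartzMap.fourier_coe, h1]
  simp only [h3, h4, zero_smul, integral_zero] at h2
  rw [h2]
  refine integral_congr_ae (Eventually.of_forall fun v => ?_)
  simp [mul_comm]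

lemma mul_modGauss_exp_le {c : ℝ} (x : ℝ) (ξ v : Ev n) :
    |x| * ‖modGauss ξ v‖ * Real.exp (c * ‖v‖)
      ≤ x ^ 2 + Real.exp (4 * c ^ 2) * ‖modGauss (0 : Ev n) v‖ := by
  have hm (ξ : Ev n) : ‖modGauss ξ v‖ = Real.exp (-(‖v‖ ^ 2 / 4)) := by
    rw [modGauss_apply, Complex.norm_exp, gaussPhase_re]
  rw [hm, hm, mul_assoc, ← Real.exp_add, ← Real.exp_add]
  set y := Real.exp (-(‖v‖ ^ 2 / 4) + c * ‖v‖)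
  have hy : y ^ 2 ≤ Real.exp (4 * c ^ 2 + -(‖v‖ ^ 2 / 4)) := by
    rw [← Real.exp_nat_mul]
    gcongr
    push_cast
    nlinarith [sq_nonneg (‖v‖ - 4 * c)]
  nlinarith [sq_nonneg (|x| - y), sq_abs x, sq_nonneg x, sq_nonneg y]

lemma integrable_mul_modGauss_exp (g : HV n) (ξ : Ev n) (c : ℝ) :
    Integrable fun v => ‖g v * modGauss ξ v‖ * Real.exp (c * ‖v‖) := by
  have h1 : Integrable fun v => ‖g v‖ ^ 2 := (Lp.memLp g).integrable_norm_pow (by norm_num)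
  have h2 : Integrable fun v => Real.exp (4 * c ^ 2) * ‖modGauss (0 : Ev n) v‖ :=
    (modGauss (0 : Ev n)).integrable.norm.const_mul _
  refine (h1.add h2).mono' ?_ (Eventually.of_forall fun v => ?_)
  · exact (((Lp.aestronglyMeasurable g).mul (modGauss ξ).continuous.aestronglyMeasurable).norm).mul
      (by fun_prop : Continuous fun v : Ev n => Real.exp (c * ‖v‖)).aestronglyMeasurable
  · rw [Real.norm_of_nonneg (by positivity), norm_mul]
    simpa using mul_modGauss_exp_le ‖g v‖ ξ v

lemma eq_zero_of_forall_integral_hermiteFun (ξ : Ev n) (g : HV n)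
    (h : ∀ p, ∫ v, g v * hermiteFun ξ p v = 0) : g = 0 := by
  have hF : Integrable fun v => g v * modGauss ξ v := by
    have h0 := integrable_mul_modGauss_exp g ξ 0
    simp only [zero_mul, Real.exp_zero, mul_one] at h0
    exact (integrable_norm_iff ((Lp.aestronglyMeasurable g).mul
      (modGauss ξ).continuous.aestronglyMeasurable)).1 h0
  have hzero : ∀ᵐ v, g v * modGauss ξ v = 0 := by
    refine ae_eq_zero_of_fourier_eq_zero hF fun w => ?_
    rw [Real.fourier_eq']
    let q : MvPolynomial (Fin n) ℂ :=
      ∑ j, MvPolynomial.C (((-2 * π * w j : ℝ) : ℂ) * Complex.I) * MvPolynomial.X j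
    have hq (v : Ev n) : polyEval q v = ((-2 * π * inner ℝ v w : ℝ) : ℂ) * Complex.I := by
      simp only [polyEval, q, map_sum, map_mul, MvPolynomial.eval_C, MvPolynomial.eval_X,
        PiLp.inner_apply, Real.inner_apply]
      push_cast
      rw [Finset.mul_sum, Finset.sum_mul]
      refine Finset.sum_congr rfl fun j _ => ?_
      simp
      ring
    have hqn (v : Ev n) : ‖polyEval q v‖ ≤ 2 * π * ‖w‖ * ‖v‖ := by
      rw [hq, norm_mul, Complex.norm_I, mul_one, Complex.norm_real, norm_mul, norm_mul,
        Real.norm_of_nonneg pi_pos.le]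
      have := norm_inner_le_norm (𝕜 := ℝ) v w
      norm_num
      rw [Real.norm_eq_abs] at this
      nlinarith [pi_pos]
    have hexp (r : ℝ) : HasSum (fun m : ℕ => r ^ m / m.factorial) (Real.exp r) := by
      rw [Real.exp_eq_exp_ℝ]
      exact NormedSpace.expSeries_div_hasSum_exp r
    have hs := hasSum_integral_of_dominated_convergence (μ := (volume : Measure (Ev n)))
      (F := fun (m : ℕ) v => g v * hermiteFun ξ (MvPolynomial.C ((m.factorial : ℂ)⁻¹) * q ^ m) v)
      (f := fun v => cexp (((-2 * π * inner ℝ v w : ℝ) : ℂ) * Complex.I) • (g v * modGauss ξ v))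
      (fun m v => ‖g v * modGauss ξ v‖ * ((2 * π * ‖w‖ * ‖v‖) ^ m / m.factorial))
      (fun m => (Lp.aestronglyMeasurable g).mul (SchwartzMap.continuous _).aestronglyMeasurable)
      (fun m => Eventually.of_forall fun v => ?_)
      (Eventually.of_forall fun v => ((hexp _).summable.mul_left _))
      ?_ (Eventually.of_forall fun v => ?_)
    · have h0 : ∀ m : ℕ, ∫ v, g v *
          hermiteFun ξ (MvPolynomial.C ((m.factorial : ℂ)⁻¹) * q ^ m) v = 0 := fun m => h _
      simp only [h0] at hs
      exact hs.unique hasSum_zero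
    · have h1 : hermiteFun ξ (MvPolynomial.C ((m.factorial : ℂ)⁻¹) * q ^ m) v
          = (m.factorial : ℂ)⁻¹ * polyEval q v ^ m * modGauss ξ v := by
        rw [hermiteFun_apply, modGauss_apply]
        simp [polyEval]
      rw [h1, norm_mul, norm_mul, norm_mul, norm_mul, norm_pow, norm_inv, Complex.norm_natCast]
      calc ‖g v‖ * ((m.factorial : ℝ)⁻¹ * ‖polyEval q v‖ ^ m * ‖modGauss ξ v‖)
          = ‖g v‖ * ‖modGauss ξ v‖ * (‖polyEval q v‖ ^ m / m.factorial) := by ring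
        _ ≤ _ := by
          gcongr
          exact hqn v
    · have h1 (v : Ev n) : ∑' m : ℕ, ‖g v * modGauss ξ v‖ *
          ((2 * π * ‖w‖ * ‖v‖) ^ m / m.factorial)
          = ‖g v * modGauss ξ v‖ * Real.exp (2 * π * ‖w‖ * ‖v‖) := by
        rw [tsum_mul_left, (hexp _).tsum_eq]
      simp only [h1]
      exact integrable_mul_modGauss_exp g ξ _
    · have h1 : HasSum (fun m : ℕ => polyEval q v ^ m / m.factorial) (cexp (polyEval q v)) := by
        rw [Complex.exp_eq_exp_ℂ]
        exact NormedSpace.expSeries_div_hasSum_exp _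
      have h2 := h1.mul_right (g v * modGauss ξ v)
      rw [hq] at h2
      refine h2.congr_fun fun m => ?_
      rw [hermiteFun_apply, modGauss_apply, ← hq]
      simp only [polyEval, map_mul, map_pow, MvPolynomial.eval_C]
      ring
  rw [Lp.eq_zero_iff_ae_eq_zero]
  filter_upwards [hzero] with v hv
  rcases mul_eq_zero.1 hv with h1 | h1
  · exact h1
  · exact absurd h1 (Complex.exp_ne_zero _)

/-- The inclusion of the Hermite functions in `L²`. -/
def hermiteLp (ξ : Ev n) : MvPolynomial (Fin n) ℂ →ₗ[ℂ] HV n :=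
  (toLpCLM ℂ ℂ 2 volume).toLinearMap ∘ₗ hermiteFun ξ

lemma hermiteLp_apply (ξ : Ev n) (p : MvPolynomial (Fin n) ℂ) :
    hermiteLp ξ p = (hermiteFun ξ p).toLp 2 volume := rfl

lemma denseRange_hermiteLp (ξ : Ev n) : DenseRange (hermiteLp ξ) := by
  have h : Dense ((LinearMap.range (hermiteLp ξ) : Submodule ℂ (HV n)) : Set (HV n)) := by
    rw [Submodule.dense_iff_topologicalClosure_eq_top, Submodule.topologicalClosure_eq_top_iff,
      eq_bot_iff]
    intro f hf
    have h0 : star f = 0 := by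
      refine eq_zero_of_forall_integral_hermiteFun ξ (star f) fun p => ?_
      rw [integral_mul_schwartz, star_star, ← hermiteLp_apply]
      exact Submodule.inner_left_of_mem_orthogonal (LinearMap.mem_range_self _ p) hf
    rw [Submodule.mem_bot, ← norm_eq_zero, ← norm_star_Lp, h0, norm_zero]
  rwa [LinearMap.coe_range] at h

end Density

section Fiber

open SchwartzMap LineDeriv

variable {n : ℕ}

lemma pderiv_pderiv_comm (j k : Fin n) (p : MvPolynomial (Fin n) ℂ) :
    MvPolynomial.pderiv j (MvPolynomial.pderiv k p)
      = MvPolynomial.pderiv k (MvPolynomial.pderiv j p) := by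
  have h : ⁅(MvPolynomial.pderiv j : Derivation ℂ (MvPolynomial (Fin n) ℂ) (MvPolynomial (Fin n) ℂ)),
      (MvPolynomial.pderiv k : Derivation ℂ (MvPolynomial (Fin n) ℂ) (MvPolynomial (Fin n) ℂ))⁆
        = 0 := by
    refine MvPolynomial.derivation_ext fun i => ?_
    rw [Derivation.commutator_apply]
    simp only [MvPolynomial.pderiv_X, Pi.single_apply]
    split_ifs <;> simp
  have h1 := DFunLike.congr_fun h p
  rw [Derivation.commutator_apply] at h1
  exact sub_eq_zero.1 h1

/-- The action of `∂ⱼ` on polynomials times the modulated Gaussian. -/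
def twistDeriv (ξ : Ev n) (j : Fin n) (p : MvPolynomial (Fin n) ℂ) : MvPolynomial (Fin n) ℂ :=
  MvPolynomial.pderiv j p
    - (MvPolynomial.C (1 / 2) * MvPolynomial.X j + MvPolynomial.C (Complex.I * (ξ j : ℂ))) * p

lemma fderiv_hermiteFun (ξ : Ev n) (j : Fin n) (p : MvPolynomial (Fin n) ℂ) (v : Ev n) :
    fderiv ℝ (hermiteFun ξ p) v (EuclideanSpace.single j 1)
      = hermiteFun ξ (twistDeriv ξ j p) v := by
  rw [lineDeriv_hermiteFun]
  simp only [hermiteFun_apply]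
  simp only [twistDeriv, polyEval, map_sub, map_add, map_mul, MvPolynomial.eval_C,
    MvPolynomial.eval_X]
  ring

lemma lineDerivOp_hermiteFun (ξ : Ev n) (j : Fin n) (p : MvPolynomial (Fin n) ℂ) :
    ∂_{EuclideanSpace.single j (1 : ℝ)} (hermiteFun ξ p) = hermiteFun ξ (twistDeriv ξ j p) := by
  ext v
  exact fderiv_hermiteFun ξ j p v

lemma conj_hermiteFun_zero (p : MvPolynomial (Fin n) ℂ) (v : Ev n) :
    (starRingEnd ℂ) (hermiteFun 0 p v)
      = hermiteFun 0 (MvPolynomial.map (starRingEnd ℂ) p) v := by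
  have h1 : (starRingEnd ℂ) (gaussPhase 0 v) = gaussPhase 0 v := by
    have : gaussPhase 0 v = ((-(‖v‖ ^ 2 / 4) : ℝ) : ℂ) := by simp [gaussPhase]
    rw [this, Complex.conj_ofReal]
  rw [hermiteFun_apply, hermiteFun_apply, map_mul, ← Complex.exp_conj, h1]
  congr 1
  simp only [polyEval]
  rw [MvPolynomial.eval_map, ← MvPolynomial.coe_eval₂Hom, ← RingHom.comp_apply]
  congr 1
  ext <;> simp

lemma inner_hermiteLp_zero (p q : MvPolynomial (Fin n) ℂ) :
    inner ℂ (hermiteLp 0 p) (hermiteLp 0 q) = schwartzPair volume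
      (hermiteFun 0 (MvPolynomial.map (starRingEnd ℂ) p)) (hermiteFun 0 q) := by
  rw [hermiteLp_apply, hermiteLp_apply, inner_toL2_toL2_eq _ _ volume, schwartzPair_apply]
  refine integral_congr_ae (Eventually.of_forall fun v => ?_)
  simp only [← conj_hermiteFun_zero]
  simp [mul_comm]

lemma hermiteLp_injective (ξ : Ev n) (p : MvPolynomial (Fin n) ℂ) (h : hermiteLp ξ p = 0) :
    p = 0 := by
  have h1 : hermiteFun ξ p = 0 := by
    refine SchwartzMap.injective_toLp 2 (volume : Measure (Ev n)) ?_
    change (hermiteFun ξ p).toLp 2 volume = (toLpCLM ℂ ℂ 2 volume) 0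
    rw [map_zero]
    exact h
  refine MvPolynomial.funext_set (fun _ => Set.range Complex.ofReal)
    (fun _ => Set.infinite_range_of_injective Complex.ofReal_injective) fun x hx => ?_
  choose y hy using fun i => hx i (Set.mem_univ i)
  have h2 := congrArg (fun f : 𝓢(Ev n, ℂ) => f (WithLp.toLp 2 y)) h1
  have h3 : polyEval p (WithLp.toLp 2 y) = 0 := by
    simpa [hermiteFun_apply, Complex.exp_ne_zero] using h2
  have h4 : x = fun j => (y j : ℂ) := funext fun i => (hy i).symm
  rw [h4, map_zero]
  exact h3

lemma inner_hermiteLp_pderiv (j : Fin n) (u w : MvPolynomial (Fin n) ℂ) :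
    inner ℂ (hermiteLp 0 (MvPolynomial.pderiv j u)) (hermiteLp 0 w)
      = inner ℂ (hermiteLp 0 u) (hermiteLp 0 (MvPolynomial.X j * w - MvPolynomial.pderiv j w)) := by
  have hc : (fun v : Ev n => (v j : ℂ) * (1 / 2)).HasTemperateGrowth :=
    (hasTemperateGrowth_coord j).mul (Function.HasTemperateGrowth.const _)
  have h1 (q : MvPolynomial (Fin n) ℂ) : hermiteFun 0 (MvPolynomial.pderiv j q)
      = ∂_{EuclideanSpace.single j (1 : ℝ)} (hermiteFun 0 q)
        + smulLeftCLM ℂ (fun v : Ev n => (v j : ℂ) * (1 / 2)) (hermiteFun 0 q) := by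
    ext v
    rw [lineDerivOp_hermiteFun, add_apply, smulLeftCLM_apply_apply hc]
    simp only [hermiteFun_apply]
    simp only [twistDeriv, polyEval, map_sub, map_add, map_mul,
      MvPolynomial.eval_C, MvPolynomial.eval_X, smul_eq_mul, PiLp.zero_apply,
      Complex.ofReal_zero]
    ring
  have h2 : hermiteFun 0 (MvPolynomial.X j * w - MvPolynomial.pderiv j w)
      = -∂_{EuclideanSpace.single j (1 : ℝ)} (hermiteFun 0 w)
        + smulLeftCLM ℂ (fun v : Ev n => (v j : ℂ) * (1 / 2)) (hermiteFun 0 w) := by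
    ext v
    rw [lineDerivOp_hermiteFun, add_apply, neg_apply, smulLeftCLM_apply_apply hc]
    simp only [hermiteFun_apply]
    simp only [twistDeriv, polyEval, map_sub, map_add, map_mul,
      MvPolynomial.eval_C, MvPolynomial.eval_X, smul_eq_mul, PiLp.zero_apply,
      Complex.ofReal_zero]
    ring
  rw [inner_hermiteLp_zero, inner_hermiteLp_zero, ← MvPolynomial.pderiv_map, h1, h2, map_add,
    map_add, map_neg, schwartzPair_lineDeriv, schwartzPair_smulLeft hc,
    LinearMap.add_apply, neg_neg]

/-- The annihilation operators of the Hermite functions. -/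
def hermiteAnn (j : Fin n) : MvPolynomial (Fin n) ℂ →ₗ[ℂ] MvPolynomial (Fin n) ℂ where
  toFun p := MvPolynomial.pderiv j p
  map_add' := map_add _
  map_smul' := (MvPolynomial.pderiv j).map_smul

lemma hermiteAnn_apply (j : Fin n) (p : MvPolynomial (Fin n) ℂ) :
    hermiteAnn j p = MvPolynomial.pderiv j p := rfl

/-- The creation operators of the Hermite functions. -/
def hermiteCre (j : Fin n) : MvPolynomial (Fin n) ℂ →ₗ[ℂ] MvPolynomial (Fin n) ℂ where
  toFun p := MvPolynomial.X j * p - MvPolynomial.pderiv j p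
  map_add' p q := by
    rw [map_add]
    ring
  map_smul' c p := by
    rw [Derivation.map_smul, RingHom.id_apply, smul_sub, mul_smul_comm]

lemma hermiteCre_apply (j : Fin n) (p : MvPolynomial (Fin n) ℂ) :
    hermiteCre j p = MvPolynomial.X j * p - MvPolynomial.pderiv j p := rfl

/-- The Hermite functions as a representation of the canonical commutation relations. -/
def hermiteSystem (n : ℕ) : CCRSystem n (MvPolynomial (Fin n) ℂ) (HV n) where
  a := hermiteAnn
  ad := hermiteCre
  e := hermiteLp 0
  inj := hermiteLp_injective 0
  adj := inner_hermiteLp_pderiv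
  comm j k u := by
    simp only [hermiteAnn_apply, hermiteCre_apply]
    rw [map_sub, pderiv_pderiv_comm j k, MvPolynomial.pderiv_mul]
    split_ifs with h
    · rw [h, MvPolynomial.pderiv_X_self]
      ring
    · rw [MvPolynomial.pderiv_X_of_ne (Ne.symm h)]
      ring
  comm_a := pderiv_pderiv_comm
  comm_ad j k u := by
    simp only [hermiteCre_apply]
    rw [map_sub, map_sub, pderiv_pderiv_comm j k, MvPolynomial.pderiv_mul, MvPolynomial.pderiv_mul]
    rcases eq_or_ne j k with rfl | h
    · rfl
    · rw [MvPolynomial.pderiv_X_of_ne h, MvPolynomial.pderiv_X_of_ne h.symm]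
      ring

end Fiber

section Fiber

open SchwartzMap LineDeriv

variable {n : ℕ}

lemma hermiteSystem_a (j : Fin n) (p : MvPolynomial (Fin n) ℂ) :
    (hermiteSystem n).a j p = MvPolynomial.pderiv j p := rfl

lemma hermiteSystem_ad (j : Fin n) (p : MvPolynomial (Fin n) ℂ) :
    (hermiteSystem n).ad j p = MvPolynomial.X j * p - MvPolynomial.pderiv j p := rfl

lemma hermiteSystem_cyclic (S : Submodule ℂ (MvPolynomial (Fin n) ℂ)) (h1 : 1 ∈ S)
    (h : ∀ j, ∀ u ∈ S, (hermiteSystem n).ad j u ∈ S) : S = ⊤ := by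
  have hmon : ∀ (N : ℕ) (m : Fin n →₀ ℕ), m.degree = N → MvPolynomial.monomial m (1 : ℂ) ∈ S := by
    intro N
    induction N using Nat.strong_induction_on with
    | _ N ih =>
      intro m hm
      rcases eq_or_ne m 0 with rfl | hm0
      · exact h1
      · obtain ⟨j, hj⟩ := Finsupp.ne_iff.1 hm0
        obtain ⟨m', rfl⟩ : ∃ m', m = m' + Finsupp.single j 1 :=
          ⟨m - Finsupp.single j 1, (tsub_add_cancel_of_le (by
            rw [Finsupp.single_le_iff]
            exact Nat.one_le_iff_ne_zero.2 hj)).symm⟩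
        have hdeg : m'.degree + 1 = N := by
          rw [← hm, map_add, Finsupp.degree_single]
        have h2 := h j _ (ih _ (by omega) m' rfl)
        rw [hermiteSystem_ad] at h2
        have h3 : MvPolynomial.pderiv j (MvPolynomial.monomial m' (1 : ℂ)) ∈ S := by
          rw [MvPolynomial.pderiv_monomial]
          rcases eq_or_ne (m' j) 0 with h0 | h0
          · simp [h0]
          · rw [one_mul, ← mul_one ((m' j : ℕ) : ℂ), ← smul_eq_mul, ← MvPolynomial.smul_monomial]
            refine S.smul_mem _ (ih (m' - Finsupp.single j 1).degree ?_ _ rfl)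
            have h4 : m' = (m' - Finsupp.single j 1) + Finsupp.single j 1 :=
              (tsub_add_cancel_of_le (by
                rw [Finsupp.single_le_iff]
                exact Nat.one_le_iff_ne_zero.2 h0)).symm
            have h5 := congrArg Finsupp.degree h4
            rw [map_add, Finsupp.degree_single] at h5
            omega
        have h4 := S.add_mem h2 h3
        rw [sub_add_cancel] at h4
        rw [add_comm m', MvPolynomial.monomial_single_add, pow_one]
        exact h4
  rw [eq_top_iff]
  intro p _
  rw [p.as_sum]
  refine S.sum_mem fun m _ => ?_
  rw [← mul_one (p.coeff m), ← smul_eq_mul, ← MvPolynomial.smul_monomial]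
  exact S.smul_mem _ (hmon _ m rfl)

lemma exists_hermite_filtration (n : ℕ) : ∃ W : ℕ → Submodule ℂ (MvPolynomial (Fin n) ℂ),
    W 0 = ⊥ ∧ (∀ u, ∃ d, u ∈ W d) ∧
      (∀ d j, ∀ u ∈ W (d + 1), (hermiteSystem n).a j u ∈ W d) ∧
      (∀ d : ℕ, ∀ u ∈ W (d + 1), (hermiteSystem n).num u - (d : ℂ) • u ∈ W d) :=
  (hermiteSystem n).exists_filtration 1 (fun _ => MvPolynomial.pderiv_one) hermiteSystem_cyclic

lemma hermite_gauged_surjective (ξ : Ev n) (z : ℂ) (hz : ¬(0 ≤ z.re ∧ z.im = 0))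
    (g : MvPolynomial (Fin n) ℂ) : ∃ u, (hermiteSystem n).gauged ξ u - z • u = g := by
  obtain ⟨W, h0, hW, ha, hnum⟩ := exists_hermite_filtration n
  exact (hermiteSystem n).gauged_surjective h0 hW ha hnum hz ξ g

lemma norm_hermiteLp (ξ : Ev n) (p : MvPolynomial (Fin n) ℂ) :
    ‖hermiteLp ξ p‖ = ‖hermiteLp 0 p‖ := by
  rw [Lp.norm_def, Lp.norm_def]
  congr 1
  refine eLpNorm_congr_norm_ae ?_
  filter_upwards [(hermiteFun ξ p).coeFn_toLp 2 volume, (hermiteFun 0 p).coeFn_toLp 2 volume]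
    with v h1 h2
  rw [hermiteLp_apply, hermiteLp_apply, h1, h2, hermiteFun_apply, hermiteFun_apply, norm_mul,
    norm_mul, Complex.norm_exp, Complex.norm_exp, gaussPhase_re, gaussPhase_re]

lemma hermite_uniform_estimate (n : ℕ) (z : ℂ) (hz : ¬(0 ≤ z.re ∧ z.im = 0)) :
    ∃ C : ℝ, 0 ≤ C ∧ ∀ (ξ η : Ev n) (u : MvPolynomial (Fin n) ℂ),
      ‖hermiteLp η u‖ ≤ C * ‖hermiteLp η ((hermiteSystem n).gauged ξ u - z • u)‖ := by
  obtain ⟨C, hC, h⟩ := (hermiteSystem n).uniform_estimate hermite_gauged_surjective hz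
  refine ⟨C, hC, fun ξ η u => ?_⟩
  rw [norm_hermiteLp, norm_hermiteLp η]
  exact h ξ u

/-- The potential of the oscillator `Phat0t`. -/
def fiberPotential (ξ v : Ev n) : ℂ :=
  ((‖v‖ ^ 2 / 4 - (n : ℝ) / 2 : ℝ) : ℂ) + Complex.I * ((∑ j, v j * ξ j : ℝ) : ℂ)

lemma hasTemperateGrowth_fiberPotential (ξ : Ev n) : (fiberPotential ξ).HasTemperateGrowth := by
  have h : fiberPotential ξ = (fun _ => -(n / 2 : ℂ)) - gaussPhase ξ := by
    funext v
    simp only [fiberPotential, gaussPhase, Pi.sub_apply]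
    push_cast
    ring
  rw [h]
  exact (Function.HasTemperateGrowth.const _).sub (hasTemperateGrowth_gaussPhase ξ)

/-- The complex harmonic oscillator on Schwartz functions. -/
def fiberOp (ξ : Ev n) : 𝓢(Ev n, ℂ) →L[ℂ] 𝓢(Ev n, ℂ) :=
  -∑ j : Fin n, (lineDerivOpCLM ℂ 𝓢(Ev n, ℂ) (EuclideanSpace.single j (1 : ℝ))) ∘L
      (lineDerivOpCLM ℂ 𝓢(Ev n, ℂ) (EuclideanSpace.single j (1 : ℝ)))
    + smulLeftCLM ℂ (fiberPotential ξ)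

lemma fiberOp_eq (ξ : Ev n) (φ : 𝓢(Ev n, ℂ)) : fiberOp ξ φ
    = -∑ j : Fin n, ∂_{EuclideanSpace.single j (1 : ℝ)} (∂_{EuclideanSpace.single j (1 : ℝ)} φ)
      + smulLeftCLM ℂ (fiberPotential ξ) φ := by
  simp [fiberOp, lineDerivOpCLM_apply]

lemma fiberOp_apply (ξ : Ev n) (φ : 𝓢(Ev n, ℂ)) (v : Ev n) :
    fiberOp ξ φ v = Phat0t n ξ φ v := by
  have h (j : Fin n) : (∂_{EuclideanSpace.single j (1 : ℝ)}
      (∂_{EuclideanSpace.single j (1 : ℝ)} φ)) v = djV n (fun w => djV n φ j w) j v := rfl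
  rw [fiberOp_eq, add_apply, neg_apply, sum_apply,
    smulLeftCLM_apply_apply (hasTemperateGrowth_fiberPotential ξ)]
  simp only [h, Phat0t, lapV, fiberPotential, smul_eq_mul]
  ring

lemma schwartzPair_fiberOp (ξ : Ev n) (f g : 𝓢(Ev n, ℂ)) :
    schwartzPair volume f (fiberOp ξ g) = schwartzPair volume (fiberOp ξ f) g := by
  simp only [fiberOp_eq, map_add, map_neg, map_sum, schwartzPair_lineDeriv, neg_neg,
    LinearMap.add_apply, LinearMap.neg_apply, LinearMap.sum_apply,
    schwartzPair_smulLeft (hasTemperateGrowth_fiberPotential ξ)]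

lemma fiberOp_hermiteFun (ξ : Ev n) (p : MvPolynomial (Fin n) ℂ) :
    fiberOp ξ (hermiteFun ξ p) = hermiteFun ξ ((hermiteSystem n).gauged ξ p) := by
  ext v
  rw [fiberOp_eq, add_apply, neg_apply, sum_apply,
    smulLeftCLM_apply_apply (hasTemperateGrowth_fiberPotential ξ)]
  simp only [lineDerivOp_hermiteFun, CCRSystem.gauged_apply, CCRSystem.num_apply,
    CCRSystem.lower_apply, hermiteSystem_a, hermiteSystem_ad, fiberPotential, smul_eq_mul]
  simp only [hermiteFun_apply]
  rw [← Finset.sum_mul, ← neg_mul, ← mul_assoc, ← add_mul]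
  congr 1
  have hv : ((‖v‖ ^ 2 / 4 - (n : ℝ) / 2 : ℝ) : ℂ) = ∑ j, ((v j : ℂ) ^ 2 / 4 - 1 / 2) := by
    rw [EuclideanSpace.norm_sq_eq]
    push_cast
    simp [Finset.sum_mul, ← Complex.ofReal_pow, div_eq_mul_inv]
  have hξ : ((‖ξ‖ ^ 2 : ℝ) : ℂ) = ∑ j, (ξ j : ℂ) ^ 2 := by
    rw [EuclideanSpace.norm_sq_eq]
    simp [← Complex.ofReal_pow]
  rw [hv, hξ]
  simp only [polyEval, map_add, map_sum, MvPolynomial.smul_eval, Finset.mul_sum, Finset.sum_mul,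
    Complex.ofReal_sum, ← Finset.sum_neg_distrib, ← Finset.sum_add_distrib]
  refine Finset.sum_congr rfl fun j _ => ?_
  simp only [twistDeriv, map_sub, map_add, map_mul, MvPolynomial.eval_C, MvPolynomial.eval_X,
    MvPolynomial.pderiv_mul, MvPolynomial.pderiv_C, MvPolynomial.pderiv_X_self, map_zero, map_one,
    Complex.ofReal_mul]
  ring_nf
  simp only [Complex.I_sq]
  ring

end Fiber

section FiberResolvent

open SchwartzMap

lemma integral_apply_mul_of_resolvent {E V : Type*} [NormedAddCommGroup E] [NormedSpace ℝ E]
    [MeasurableSpace E] [BorelSpace E] [SecondCountableTopology E] {μ : Measure E}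
    [μ.HasTemperateGrowth]
    [AddCommGroup V] [Module ℂ V] {e : V →ₗ[ℂ] 𝓢(E, ℂ)} {T : V →ₗ[ℂ] V}
    (he : DenseRange fun u => (e u).toLp 2 μ) (hT : Function.Surjective T)
    {R : Lp ℂ 2 μ →L[ℂ] Lp ℂ 2 μ} (hR : ∀ u, R ((e (T u)).toLp 2 μ) = (e u).toLp 2 μ)
    {Q Q' : 𝓢(E, ℂ) →L[ℂ] 𝓢(E, ℂ)}
    (hQ : ∀ f g, schwartzPair μ (Q' f) g = schwartzPair μ f (Q g))
    (hQe : ∀ u, Q' (e u) = e (T u)) (f : Lp ℂ 2 μ) (φ : 𝓢(E, ℂ)) :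
    ∫ x, R f x * Q φ x ∂μ = ∫ x, f x * φ x ∂μ := by
  simp only [integral_lp_mul_schwartz]
  have h1 : Continuous fun f : Lp ℂ 2 μ => inner ℂ (star ((Q φ).toLp 2 μ)) (R f) :=
    continuous_const.inner R.continuous
  have h2 : Continuous fun f : Lp ℂ 2 μ => inner ℂ (star (φ.toLp 2 μ)) f :=
    continuous_const.inner continuous_id
  refine congrFun (h1.ext_on he h2 ?_) f
  rintro _ ⟨u, rfl⟩
  obtain ⟨w, rfl⟩ := hT u
  simp only [hR, ← integral_lp_mul_schwartz, integral_toLp_mul]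
  have h := hQ (e w) φ
  rw [hQe, schwartzPair_apply, schwartzPair_apply] at h
  exact h.symm

variable {n : ℕ}

/-- The oscillator `fiberOp` shifted by `z`. -/
def fiberOpSub (ξ : Ev n) (z : ℂ) : 𝓢(Ev n, ℂ) →L[ℂ] 𝓢(Ev n, ℂ) :=
  fiberOp ξ - z • ContinuousLinearMap.id ℂ _

/-- The gauged number operator of the Hermite system, shifted by `z`. -/
def hermiteGaugedSub (ξ : Ev n) (z : ℂ) : MvPolynomial (Fin n) ℂ →ₗ[ℂ] MvPolynomial (Fin n) ℂ :=
  (hermiteSystem n).gauged ξ - z • LinearMap.id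

lemma hermiteGaugedSub_apply (ξ : Ev n) (z : ℂ) (p : MvPolynomial (Fin n) ℂ) :
    hermiteGaugedSub ξ z p = (hermiteSystem n).gauged ξ p - z • p := rfl

lemma schwartzPair_fiberOpSub (ξ : Ev n) (z : ℂ) (f g : 𝓢(Ev n, ℂ)) :
    schwartzPair volume (fiberOpSub ξ z f) g
      = schwartzPair volume f (fiberOpSub ξ z g) := by
  simp only [fiberOpSub, sub_apply, smul_apply, ContinuousLinearMap.id_apply,
    map_sub, map_smul, LinearMap.sub_apply, LinearMap.smul_apply, schwartzPair_fiberOp]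

lemma fiberOpSub_apply (ξ : Ev n) (z : ℂ) (φ : 𝓢(Ev n, ℂ)) (v : Ev n) :
    fiberOpSub ξ z φ v = Phat0t n ξ φ v - z * φ v := by
  rw [← fiberOp_apply]
  simp [fiberOpSub]

lemma fiberOpSub_hermiteFun (ξ : Ev n) (z : ℂ) (p : MvPolynomial (Fin n) ℂ) :
    fiberOpSub ξ z (hermiteFun ξ p)
      = hermiteFun ξ ((hermiteGaugedSub ξ z) p) := by
  rw [fiberOpSub, sub_apply, smul_apply, fiberOp_hermiteFun, hermiteGaugedSub_apply, map_sub,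
    map_smul]
  rfl

lemma hermiteGaugedSub_surjective (ξ : Ev n) {z : ℂ} (hz : ¬(0 ≤ z.re ∧ z.im = 0)) :
    Function.Surjective (hermiteGaugedSub ξ z) := fun g =>
  (hermite_gauged_surjective ξ z hz g).imp fun _ hu => hu

lemma IsTestV.toSchwartz {φ : Ev n → ℂ} (hφ : IsTestV n φ) :
    ∃ ψ : 𝓢(Ev n, ℂ), (ψ : Ev n → ℂ) = φ :=
  ⟨hφ.2.toSchwartzMap hφ.1, rfl⟩

lemma exists_isResV {z : ℂ} (hz : ¬(0 ≤ z.re ∧ z.im = 0)) (ξ : Ev n) : ∃ R, IsResV n ξ z R := by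
  obtain ⟨C, hC, h⟩ := hermite_uniform_estimate n z hz
  obtain ⟨R, hR, -⟩ := exists_resolvent (hermiteLp ξ)
    (hermiteGaugedSub ξ z) (denseRange_hermiteLp ξ)
    (hermiteGaugedSub_surjective ξ hz) hC fun u => h ξ ξ u
  refine ⟨R, fun f φ hφ => ?_⟩
  obtain ⟨ψ, rfl⟩ := hφ.toSchwartz
  simp only [← fiberOpSub_apply]
  exact integral_apply_mul_of_resolvent (denseRange_hermiteLp ξ)
    (hermiteGaugedSub_surjective ξ hz) hR (schwartzPair_fiberOpSub ξ z)
    (fiberOpSub_hermiteFun ξ z) f ψ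

lemma exists_forall_isResV_norm_le {z : ℂ} (hz : ¬(0 ≤ z.re ∧ z.im = 0)) :
    ∃ C : ℝ, ∀ ξ R, IsResV n ξ z R → ‖R‖ ≤ C := by
  obtain ⟨C, hC, h⟩ := hermite_uniform_estimate n z hz
  refine ⟨C, fun ξ R hR => R.opNorm_le_bound hC fun f => ?_⟩
  have key (x : HV n) : ‖inner ℂ (star (R f)) x‖ ≤ ‖f‖ * C * ‖x‖ := by
    refine (denseRange_hermiteLp ξ).induction_on x
      (isClosed_le (by fun_prop) (by fun_prop)) fun g => ?_
    obtain ⟨u, rfl⟩ := hermiteGaugedSub_surjective ξ hz g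
    have h1 := weak_eq_schwartz (fiberOpSub ξ z) (R f) f
      (fun φ hφ => by simpa only [fiberOpSub_apply] using hR f φ ⟨φ.smooth ⊤, hφ⟩)
      (hermiteFun ξ u)
    rw [integral_mul_schwartz, integral_mul_schwartz, fiberOpSub_hermiteFun] at h1
    rw [hermiteLp_apply, h1]
    refine (norm_inner_le_norm _ _).trans ?_
    rw [norm_star_Lp, mul_assoc]
    gcongr
    exact h ξ ξ u
  have h2 := key (star (R f))
  rw [inner_self_eq_norm_sq_to_K, norm_star_Lp, norm_pow] at h2
  simp only [RCLike.norm_ofReal, abs_norm] at h2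
  rcases (norm_nonneg (R f)).eq_or_lt with h0 | h0
  · rw [← h0]; positivity
  · nlinarith

end FiberResolvent

section SchwartzTensor

open SchwartzMap LineDeriv

variable {E F : Type*} [NormedAddCommGroup E] [NormedSpace ℝ E] [NormedAddCommGroup F]
  [NormedSpace ℝ F]

lemma norm_iteratedFDeriv_comp_clm_le {G : Type*} [NormedAddCommGroup G] [NormedSpace ℝ G]
    (f : 𝓢(E, ℂ)) (L : G →L[ℝ] E) (hL : ‖L‖ ≤ 1) (x : G) (i : ℕ) :
    ‖iteratedFDeriv ℝ i (fun x => f (L x)) x‖ ≤ ‖iteratedFDeriv ℝ i f (L x)‖ := by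
  have h := L.iteratedFDeriv_comp_right (f.smooth i) x le_rfl
  have h' : (fun x => f (L x)) = f ∘ L := rfl
  rw [h', h]
  refine (ContinuousMultilinearMap.norm_compContinuousLinearMap_le _ _).trans ?_
  refine mul_le_of_le_one_right (norm_nonneg _) ?_
  exact Finset.prod_le_one (fun _ _ => norm_nonneg _) fun _ _ => hL

/-- The tensor product of two Schwartz functions. -/
def schwartzTensor (f : 𝓢(E, ℂ)) (g : 𝓢(F, ℂ)) : 𝓢(E × F, ℂ) where
  toFun p := f p.1 * g p.2
  smooth' := (f.smooth ⊤).fst'.mul (g.smooth ⊤).snd'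
  decay' k n := by
    choose Cf hf0 hf using f.decay
    choose Cg hg0 hg using g.decay
    refine ⟨∑ i ∈ Finset.range (n + 1),
      (n.choose i : ℝ) * (Cf k i * Cg 0 (n - i) + Cf 0 i * Cg k (n - i)), fun p => ?_⟩
    have h1 := norm_iteratedFDeriv_mul_le (𝕜 := ℝ) (f.smooth n).fst' (g.smooth n).snd' p
      (n := n) le_rfl
    refine (mul_le_mul_of_nonneg_left h1 (by positivity)).trans ?_
    rw [Finset.mul_sum]
    refine Finset.sum_le_sum fun i _ => ?_
    have hf' := norm_iteratedFDeriv_comp_clm_le f (ContinuousLinearMap.fst ℝ E F)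
      (ContinuousLinearMap.norm_fst_le ℝ E F) p i
    have hg' := norm_iteratedFDeriv_comp_clm_le g (ContinuousLinearMap.snd ℝ E F)
      (ContinuousLinearMap.norm_snd_le ℝ E F) p (n - i)
    have hk : ‖p‖ ^ k ≤ ‖p.1‖ ^ k + ‖p.2‖ ^ k := by
      rcases max_choice ‖p.1‖ ‖p.2‖ with h | h <;> rw [Prod.norm_def, h]
      · exact le_add_of_nonneg_right (by positivity)
      · exact le_add_of_nonneg_left (by positivity)
    have e1 := hf k i p.1
    have e2 := hf 0 i p.1
    have e3 := hg k (n - i) p.2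
    have e4 := hg 0 (n - i) p.2
    rw [pow_zero, one_mul] at e2 e4
    simp only [ContinuousLinearMap.coe_fst', ContinuousLinearMap.coe_snd'] at hf' hg'
    calc ‖p‖ ^ k * ((n.choose i : ℝ) * ‖iteratedFDeriv ℝ i (fun x : E × F => f x.1) p‖
          * ‖iteratedFDeriv ℝ (n - i) (fun x : E × F => g x.2) p‖)
        ≤ (‖p.1‖ ^ k + ‖p.2‖ ^ k) * ((n.choose i : ℝ) * ‖iteratedFDeriv ℝ i f p.1‖
          * ‖iteratedFDeriv ℝ (n - i) g p.2‖) := by gcongr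
      _ = (n.choose i : ℝ) * ((‖p.1‖ ^ k * ‖iteratedFDeriv ℝ i f p.1‖)
          * ‖iteratedFDeriv ℝ (n - i) g p.2‖ + ‖iteratedFDeriv ℝ i f p.1‖
          * (‖p.2‖ ^ k * ‖iteratedFDeriv ℝ (n - i) g p.2‖)) := by ring
      _ ≤ _ := by
        have := hf0 k i
        have := hf0 0 i
        gcongr

lemma schwartzTensor_apply (f : 𝓢(E, ℂ)) (g : 𝓢(F, ℂ)) (p : E × F) :
    schwartzTensor f g p = f p.1 * g p.2 := rfl

/-- The shear `(x, v) ↦ (x - σ v, v)`. -/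
def shear (E : Type*) [NormedAddCommGroup E] [NormedSpace ℝ E] (σ : ℝ) : (E × E) ≃L[ℝ] (E × E) :=
  ContinuousLinearEquiv.equivOfInverse
    ((ContinuousLinearMap.fst ℝ E E - σ • ContinuousLinearMap.snd ℝ E E).prod
      (ContinuousLinearMap.snd ℝ E E))
    ((ContinuousLinearMap.fst ℝ E E + σ • ContinuousLinearMap.snd ℝ E E).prod
      (ContinuousLinearMap.snd ℝ E E))
    (fun p => by simp) (fun p => by simp)

lemma shear_apply (σ : ℝ) (p : E × E) : shear E σ p = (p.1 - σ • p.2, p.2) := rfl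

/-- The sheared tensor product `(x, v) ↦ k (x - σ v) g(v)`. -/
def shearTensor (σ : ℝ) : 𝓢(E, ℂ) →ₗ[ℂ] 𝓢(E, ℂ) →ₗ[ℂ] 𝓢(E × E, ℂ) :=
  LinearMap.mk₂ ℂ
    (fun k g => compCLMOfContinuousLinearEquiv ℂ (shear E σ) (schwartzTensor k g))
    (fun k₁ k₂ g => by ext p; simp [schwartzTensor_apply, add_mul])
    (fun c k g => by ext p; simp [schwartzTensor_apply, mul_assoc])
    (fun k g₁ g₂ => by ext p; simp [schwartzTensor_apply, mul_add])
    (fun c k g => by ext p; simp [schwartzTensor_apply, mul_left_comm])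

lemma shearTensor_apply (σ : ℝ) (k g : 𝓢(E, ℂ)) (p : E × E) :
    shearTensor σ k g p = k (p.1 - σ • p.2) * g p.2 := rfl

lemma lineDerivOp_shearTensor (σ : ℝ) (k g : 𝓢(E, ℂ)) (m : E × E) :
    ∂_{m} (shearTensor σ k g) = shearTensor σ (∂_{m.1 - σ • m.2} k) g
      + shearTensor σ k (∂_{m.2} g) := by
  ext p
  have hk : HasFDerivAt (fun q : E × E => k (q.1 - σ • q.2))
      ((fderiv ℝ k (p.1 - σ • p.2)).comp
        (ContinuousLinearMap.fst ℝ E E - σ • ContinuousLinearMap.snd ℝ E E)) p :=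
    (k.differentiableAt.hasFDerivAt).comp p
      (ContinuousLinearMap.fst ℝ E E - σ • ContinuousLinearMap.snd ℝ E E).hasFDerivAt
  have hg : HasFDerivAt (fun q : E × E => g q.2)
      ((fderiv ℝ g p.2).comp (ContinuousLinearMap.snd ℝ E E)) p :=
    (g.differentiableAt.hasFDerivAt).comp p (ContinuousLinearMap.snd ℝ E E).hasFDerivAt
  have h := (hk.mul hg).fderiv
  rw [add_apply, shearTensor_apply, shearTensor_apply, lineDerivOp_apply_eq_fderiv,
    lineDerivOp_apply_eq_fderiv, lineDerivOp_apply_eq_fderiv]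
  have h' : (shearTensor σ k g : E × E → ℂ)
    = (fun q : E × E => k (q.1 - σ • q.2)) * fun q : E × E => g q.2 := rfl
  rw [h', h]
  simp only [add_apply, smul_apply, ContinuousLinearMap.comp_apply, sub_apply,
    ContinuousLinearMap.coe_fst', ContinuousLinearMap.coe_snd', smul_eq_mul]
  ring

end SchwartzTensor

section PhaseSpace

open SchwartzMap LineDeriv

variable {n : ℕ}

instance isAddHaarMeasure_phaseN : (volume : Measure (PhaseN n)).IsAddHaarMeasure :=
  inferInstanceAs ((volume : Measure (Ev n)).prod volume).IsAddHaarMeasure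

lemma hasTemperateGrowth_coord_snd (j : Fin n) :
    (fun p : PhaseN n => (p.2 j : ℂ)).HasTemperateGrowth :=
  (hasTemperateGrowth_coord j).comp (ContinuousLinearMap.snd ℝ (Ev n) (Ev n)).hasTemperateGrowth

lemma hasTemperateGrowth_potential_snd :
    (fun p : PhaseN n => fiberPotential 0 p.2).HasTemperateGrowth :=
  (hasTemperateGrowth_fiberPotential 0).comp
    (ContinuousLinearMap.snd ℝ (Ev n) (Ev n)).hasTemperateGrowth

/-- The transport operator `v_j ∂_{x_j}` on Schwartz functions of phase space. -/
def transportOp (j : Fin n) : 𝓢(PhaseN n, ℂ) →L[ℂ] 𝓢(PhaseN n, ℂ) :=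
  smulLeftCLM ℂ (fun p : PhaseN n => (p.2 j : ℂ)) ∘L
    lineDerivOpCLM ℂ 𝓢(PhaseN n, ℂ) ((EuclideanSpace.single j (1 : ℝ), 0) : PhaseN n)

lemma transportOp_apply (j : Fin n) (f : 𝓢(PhaseN n, ℂ)) (p : PhaseN n) :
    transportOp j f p = p.2 j * ∂_{((EuclideanSpace.single j (1 : ℝ), 0) : PhaseN n)} f p := by
  rw [transportOp, ContinuousLinearMap.comp_apply, lineDerivOpCLM_apply,
    smulLeftCLM_apply_apply (hasTemperateGrowth_coord_snd j), smul_eq_mul]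

lemma lineDerivOp_smulLeft_coord_snd (j : Fin n) (f : 𝓢(PhaseN n, ℂ)) :
    ∂_{((EuclideanSpace.single j (1 : ℝ), 0) : PhaseN n)}
      (smulLeftCLM ℂ (fun p : PhaseN n => (p.2 j : ℂ)) f) = transportOp j f := by
  ext p
  have hc : HasFDerivAt (fun p : PhaseN n => (p.2 j : ℂ))
      (Complex.ofRealCLM ∘L (EuclideanSpace.proj j : Ev n →L[ℝ] ℝ)
        ∘L ContinuousLinearMap.snd ℝ (Ev n) (Ev n)) p :=
    (Complex.ofRealCLM ∘L (EuclideanSpace.proj j : Ev n →L[ℝ] ℝ)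
        ∘L ContinuousLinearMap.snd ℝ (Ev n) (Ev n)).hasFDerivAt
  have h := (hc.mul f.differentiableAt.hasFDerivAt).fderiv
  have h' : (smulLeftCLM ℂ (fun p : PhaseN n => (p.2 j : ℂ)) f : PhaseN n → ℂ)
      = (fun p : PhaseN n => (p.2 j : ℂ)) * f := by
    funext q
    rw [smulLeftCLM_apply_apply (hasTemperateGrowth_coord_snd j)]
    rfl
  rw [transportOp_apply, lineDerivOp_apply_eq_fderiv, h', h, lineDerivOp_apply_eq_fderiv]
  simp

lemma schwartzPair_transportOp (j : Fin n) (f g : 𝓢(PhaseN n, ℂ)) :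
    schwartzPair volume f (transportOp j g) = -schwartzPair volume (transportOp j f) g := by
  rw [← lineDerivOp_smulLeft_coord_snd, schwartzPair_lineDeriv,
    schwartzPair_smulLeft (hasTemperateGrowth_coord_snd j)]
  rfl

/-- The Kramers–Fokker–Planck operator `σ v·∂_x - Δ_v + v²/4 - n/2` on Schwartz functions. -/
def kfpOp (n : ℕ) (σ : ℝ) : 𝓢(PhaseN n, ℂ) →L[ℂ] 𝓢(PhaseN n, ℂ) :=
  (σ : ℂ) • (∑ j : Fin n, transportOp j)
    - ∑ j : Fin n, (lineDerivOpCLM ℂ 𝓢(PhaseN n, ℂ)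
      ((0, EuclideanSpace.single j (1 : ℝ)) : PhaseN n)) ∘L
      (lineDerivOpCLM ℂ 𝓢(PhaseN n, ℂ)
      ((0, EuclideanSpace.single j (1 : ℝ)) : PhaseN n))
    + smulLeftCLM ℂ (fun p : PhaseN n => fiberPotential 0 p.2)

lemma kfpOp_eq (σ : ℝ) (f : 𝓢(PhaseN n, ℂ)) : kfpOp n σ f
    = (σ : ℂ) • (∑ j : Fin n, transportOp j f)
      - ∑ j : Fin n, ∂_{((0, EuclideanSpace.single j (1 : ℝ)) : PhaseN n)}
        (∂_{((0, EuclideanSpace.single j (1 : ℝ)) : PhaseN n)} f)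
      + smulLeftCLM ℂ (fun p : PhaseN n => fiberPotential 0 p.2) f := by
  simp [kfpOp, lineDerivOpCLM_apply]

lemma kfpOp_neg_one_apply (φ : 𝓢(PhaseN n, ℂ)) (p : PhaseN n) :
    kfpOp n (-1) φ p = KFP0tN n φ p := by
  have h (j : Fin n) : (∂_{((0, EuclideanSpace.single j (1 : ℝ)) : PhaseN n)}
      (∂_{((0, EuclideanSpace.single j (1 : ℝ)) : PhaseN n)} φ)) p
      = dvjN n (fun q => dvjN n φ j q) j p := rfl
  have h' (j : Fin n) : (∂_{((EuclideanSpace.single j (1 : ℝ), 0) : PhaseN n)} φ) p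
      = dxjN n φ j p := rfl
  rw [kfpOp_eq, add_apply, sub_apply, smul_apply, sum_apply, sum_apply,
    smulLeftCLM_apply_apply hasTemperateGrowth_potential_snd]
  simp only [h, h', transportOp_apply, KFP0tN, lapvN, fiberPotential, smul_eq_mul]
  simp

lemma schwartzPair_kfpOp (σ : ℝ) (f g : 𝓢(PhaseN n, ℂ)) :
    schwartzPair volume (kfpOp n σ f) g = schwartzPair volume f (kfpOp n (-σ) g) := by
  simp only [kfpOp_eq, map_add, map_sub, map_smul, map_sum, schwartzPair_lineDeriv, neg_neg,
    LinearMap.add_apply, LinearMap.sub_apply, LinearMap.sum_apply, LinearMap.smul_apply,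
    schwartzPair_smulLeft hasTemperateGrowth_potential_snd, schwartzPair_transportOp,
    Finset.sum_neg_distrib, Complex.ofReal_neg, smul_neg, neg_smul, map_neg]

lemma transportOp_shearTensor (σ : ℝ) (j : Fin n) (k g : 𝓢(Ev n, ℂ)) :
    transportOp j (shearTensor σ k g) = shearTensor σ (∂_{EuclideanSpace.single j (1 : ℝ)} k)
      (smulLeftCLM ℂ (fun v : Ev n => (v j : ℂ)) g) := by
  ext p
  rw [transportOp_apply, lineDerivOp_shearTensor, shearTensor_apply,
    smulLeftCLM_apply_apply (hasTemperateGrowth_coord j)]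
  simp only [smul_zero, sub_zero, add_apply, shearTensor_apply, lineDerivOp_apply_eq_fderiv,
    map_zero, mul_zero, add_zero, smul_eq_mul]
  ring

lemma lineDerivOp_snd_shearTensor (σ : ℝ) (v : Ev n) (k g : 𝓢(Ev n, ℂ)) :
    ∂_{((0, v) : PhaseN n)} (shearTensor σ k g)
      = -(σ : ℂ) • shearTensor σ (∂_{v} k) g + shearTensor σ k (∂_{v} g) := by
  rw [lineDerivOp_shearTensor]
  ext p
  simp [shearTensor_apply, lineDerivOp_apply_eq_fderiv, mul_assoc]

lemma lineDerivOp_snd_snd_shearTensor {σ : ℝ} (hσ : σ ^ 2 = 1) (v : Ev n) (k g : 𝓢(Ev n, ℂ)) :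
    ∂_{((0, v) : PhaseN n)} (∂_{((0, v) : PhaseN n)} (shearTensor σ k g))
      = shearTensor σ (∂_{v} (∂_{v} k)) g - (2 * σ : ℂ) • shearTensor σ (∂_{v} k) (∂_{v} g)
        + shearTensor σ k (∂_{v} (∂_{v} g)) := by
  have hσ' : (σ : ℂ) * σ = 1 := by
    rw [← sq]
    exact_mod_cast hσ
  simp only [lineDerivOp_snd_shearTensor, lineDerivOp_add, lineDerivOp_smul, smul_add, smul_smul,
    neg_mul_neg, hσ', one_smul]
  module

lemma smulLeft_potential_shearTensor (σ : ℝ) (k g : 𝓢(Ev n, ℂ)) :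
    smulLeftCLM ℂ (fun p : PhaseN n => fiberPotential 0 p.2) (shearTensor σ k g)
      = shearTensor σ k (smulLeftCLM ℂ (fiberPotential 0) g) := by
  ext p
  rw [smulLeftCLM_apply_apply hasTemperateGrowth_potential_snd, shearTensor_apply,
    shearTensor_apply, smulLeftCLM_apply_apply (hasTemperateGrowth_fiberPotential 0)]
  simp only [smul_eq_mul]
  ring

lemma kfpOp_shearTensor {σ : ℝ} (hσ : σ ^ 2 = 1) (k g : 𝓢(Ev n, ℂ)) :
    kfpOp n σ (shearTensor σ k g) = shearTensor σ k (fiberOp 0 g)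
      + ∑ j : Fin n, (σ : ℂ) • shearTensor σ (∂_{EuclideanSpace.single j (1 : ℝ)} k)
        (smulLeftCLM ℂ (fun v : Ev n => (v j : ℂ)) g
          + (2 : ℂ) • ∂_{EuclideanSpace.single j (1 : ℝ)} g)
      - ∑ j : Fin n, shearTensor σ (∂_{EuclideanSpace.single j (1 : ℝ)}
        (∂_{EuclideanSpace.single j (1 : ℝ)} k)) g := by
  simp only [kfpOp_eq, fiberOp_eq, transportOp_shearTensor, lineDerivOp_snd_snd_shearTensor hσ,
    smulLeft_potential_shearTensor, map_add, map_neg, map_sum, map_smul, smul_add, smul_smul,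
    Finset.sum_add_distrib, Finset.sum_sub_distrib, Finset.smul_sum, mul_comm (σ : ℂ)]
  abel

lemma smulLeft_coord_hermiteFun_zero (j : Fin n) (p : MvPolynomial (Fin n) ℂ) :
    smulLeftCLM ℂ (fun v : Ev n => (v j : ℂ)) (hermiteFun 0 p)
      + (2 : ℂ) • ∂_{EuclideanSpace.single j (1 : ℝ)} (hermiteFun 0 p)
      = hermiteFun 0 ((2 : ℂ) • (hermiteSystem n).a j p) := by
  ext v
  rw [lineDerivOp_hermiteFun, add_apply, smul_apply,
    smulLeftCLM_apply_apply (hasTemperateGrowth_coord j), hermiteSystem_a]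
  simp only [hermiteFun_apply]
  simp only [twistDeriv, polyEval, map_sub, map_add, map_mul, MvPolynomial.smul_eval,
    MvPolynomial.eval_C, MvPolynomial.eval_X, smul_eq_mul]
  simp
  ring

end PhaseSpace

section TensorModel

open SchwartzMap LineDeriv FourierTransform
open scoped TensorProduct

variable {n : ℕ}

/-- The algebraic model of phase space: Schwartz functions of position tensored with Hermite
functions of velocity. -/
abbrev PhaseModel (n : ℕ) := 𝓢(Ev n, ℂ) ⊗[ℂ] MvPolynomial (Fin n) ℂ

/-- The second derivative along the `j`-th axis. -/
def secondDeriv (j : Fin n) : 𝓢(Ev n, ℂ) →ₗ[ℂ] 𝓢(Ev n, ℂ) :=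
  (lineDerivOpCLM ℂ 𝓢(Ev n, ℂ) (EuclideanSpace.single j (1 : ℝ)) ∘L
    lineDerivOpCLM ℂ 𝓢(Ev n, ℂ) (EuclideanSpace.single j (1 : ℝ))).toLinearMap

lemma secondDeriv_apply (j : Fin n) (k : 𝓢(Ev n, ℂ)) : secondDeriv j k
    = ∂_{EuclideanSpace.single j (1 : ℝ)} (∂_{EuclideanSpace.single j (1 : ℝ)} k) := rfl

/-- The Kramers–Fokker–Planck operator in the model, after the shear of slope `σ`. -/
def modelOp (n : ℕ) (σ : ℝ) : PhaseModel n →ₗ[ℂ] PhaseModel n :=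
  TensorProduct.map LinearMap.id (hermiteSystem n).num
    + ∑ j : Fin n, (2 * σ : ℂ) • TensorProduct.map
      (lineDerivOpCLM ℂ 𝓢(Ev n, ℂ) (EuclideanSpace.single j (1 : ℝ))).toLinearMap
      ((hermiteSystem n).a j)
    - TensorProduct.map (∑ j : Fin n, secondDeriv j) LinearMap.id

lemma modelOp_tmul (σ : ℝ) (k : 𝓢(Ev n, ℂ)) (p : MvPolynomial (Fin n) ℂ) :
    modelOp n σ (k ⊗ₜ p) = k ⊗ₜ (hermiteSystem n).num p
      + ∑ j : Fin n, (2 * σ : ℂ) • (∂_{EuclideanSpace.single j (1 : ℝ)} k)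
        ⊗ₜ[ℂ] (hermiteSystem n).a j p
      - (∑ j : Fin n, secondDeriv j k) ⊗ₜ[ℂ] p := by
  simp [modelOp, lineDerivOpCLM_apply]

/-- The sheared embedding of the model into Schwartz functions on phase space. -/
def modelEmb (n : ℕ) (σ : ℝ) : PhaseModel n →ₗ[ℂ] 𝓢(PhaseN n, ℂ) :=
  TensorProduct.lift ((shearTensor σ).compl₂ (hermiteFun 0))

lemma modelEmb_tmul (σ : ℝ) (k : 𝓢(Ev n, ℂ)) (p : MvPolynomial (Fin n) ℂ) :
    modelEmb n σ (k ⊗ₜ p) = shearTensor σ k (hermiteFun 0 p) := rfl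

lemma kfpOp_modelEmb {σ : ℝ} (hσ : σ ^ 2 = 1) (U : PhaseModel n) :
    kfpOp n σ (modelEmb n σ U) = modelEmb n σ (modelOp n σ U) := by
  induction U using TensorProduct.induction_on with
  | zero => simp
  | add U V hU hV => simp only [map_add, hU, hV]
  | tmul k p =>
    rw [modelEmb_tmul, kfpOp_shearTensor hσ, modelOp_tmul]
    simp only [smulLeft_coord_hermiteFun_zero, map_add, map_sub, map_sum, map_smul, modelEmb_tmul,
      secondDeriv_apply, fiberOp_hermiteFun, CCRSystem.gauged_apply, CCRSystem.lower_apply,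
      TensorProduct.sum_tmul, smul_smul, mul_comm (σ : ℂ)]
    simp

/-- Partial Fourier transform in position, evaluated at a frequency. -/
def modelFourier (η : Ev n) : PhaseModel n →ₗ[ℂ] MvPolynomial (Fin n) ℂ :=
  TensorProduct.lift (LinearMap.mk₂ ℂ (fun k p => 𝓕 k η • p)
    (fun k₁ k₂ p => by rw [FourierTransform.fourier_add, add_apply, add_smul])
    (fun c k p => by rw [FourierTransform.fourier_smul, smul_apply, smul_assoc])
    (fun k p₁ p₂ => smul_add _ _ _)
    (fun c k p => smul_comm _ _ _))

lemma modelFourier_tmul (η : Ev n) (k : 𝓢(Ev n, ℂ)) (p : MvPolynomial (Fin n) ℂ) :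
    modelFourier η (k ⊗ₜ p) = 𝓕 k η • p := rfl

lemma fourier_lineDerivOp_single (j : Fin n) (k : 𝓢(Ev n, ℂ)) (η : Ev n) :
    𝓕 (∂_{EuclideanSpace.single j (1 : ℝ)} k) η = 2 * π * Complex.I * η j * 𝓕 k η := by
  have h : (inner ℝ · (EuclideanSpace.single j (1 : ℝ) : Ev n)).HasTemperateGrowth := by fun_prop
  rw [SchwartzMap.fourier_lineDerivOp_eq, smul_apply, smulLeftCLM_apply_apply h]
  simp [EuclideanSpace.inner_single_right, mul_assoc]

lemma fourier_sum_secondDeriv (k : 𝓢(Ev n, ℂ)) (η : Ev n) :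
    𝓕 (∑ j : Fin n, secondDeriv j k) η = -((‖(2 * π) • η‖ ^ 2 : ℝ) : ℂ) * 𝓕 k η := by
  have h : 𝓕 (∑ j : Fin n, secondDeriv j k) = ∑ j : Fin n, 𝓕 (secondDeriv j k) :=
    map_sum (fourierCLM ℂ 𝓢(Ev n, ℂ)) _ _
  rw [h, sum_apply]
  simp only [secondDeriv_apply, fourier_lineDerivOp_single, EuclideanSpace.norm_sq_eq,
    PiLp.smul_apply, Real.norm_eq_abs, sq_abs, Complex.ofReal_sum, ← Finset.sum_neg_distrib,
    Finset.sum_mul, smul_eq_mul]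
  refine Finset.sum_congr rfl fun j _ => ?_
  push_cast
  ring_nf
  rw [Complex.I_sq]
  ring

lemma modelFourier_modelOp {σ : ℝ} (hσ : σ ^ 2 = 1) (η : Ev n) (U : PhaseModel n) :
    modelFourier η (modelOp n σ U)
      = (hermiteSystem n).gauged ((2 * π * σ) • η) (modelFourier η U) := by
  induction U using TensorProduct.induction_on with
  | zero => simp
  | add U V hU hV => simp only [map_add, hU, hV]
  | tmul k p =>
    have hn : ‖(2 * π * σ) • η‖ ^ 2 = ‖(2 * π) • η‖ ^ 2 := by
      rw [mul_smul, mul_comm]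
      simp only [norm_smul, mul_pow, Real.norm_eq_abs, sq_abs, hσ, one_mul]
    rw [modelOp_tmul, CCRSystem.gauged_apply, hn]
    simp only [map_add, map_sub, map_sum, map_smul, modelFourier_tmul, fourier_lineDerivOp_single,
      fourier_sum_secondDeriv, CCRSystem.lower_apply, Finset.smul_sum, smul_smul, neg_mul, neg_smul,
      sub_neg_eq_add]
    congr 2
    refine Finset.sum_congr rfl fun j _ => ?_
    congr 1
    simp
    ring

/-- The restriction of an element of the model to a fixed velocity. -/
def modelSlice (v : Ev n) : PhaseModel n →ₗ[ℂ] 𝓢(Ev n, ℂ) :=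
  TensorProduct.lift (LinearMap.mk₂ ℂ (fun k p => hermiteFun 0 p v • k)
    (fun k₁ k₂ p => smul_add _ _ _)
    (fun c k p => smul_comm _ _ _)
    (fun k p₁ p₂ => by rw [map_add, add_apply, add_smul])
    (fun c k p => by rw [map_smul, smul_apply, smul_assoc]))

lemma modelSlice_tmul (v : Ev n) (k : 𝓢(Ev n, ℂ)) (p : MvPolynomial (Fin n) ℂ) :
    modelSlice v (k ⊗ₜ p) = hermiteFun 0 p v • k := rfl

lemma modelEmb_apply (σ : ℝ) (U : PhaseModel n) (p : PhaseN n) :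
    modelEmb n σ U p = modelSlice p.2 U (p.1 - σ • p.2) := by
  induction U using TensorProduct.induction_on with
  | zero => simp
  | add U V hU hV => simp only [map_add, add_apply, hU, hV]
  | tmul k p => rw [modelEmb_tmul, modelSlice_tmul, shearTensor_apply, smul_apply, smul_eq_mul,
      mul_comm]

lemma fourier_modelSlice (v η : Ev n) (U : PhaseModel n) :
    𝓕 (modelSlice v U) η = hermiteFun 0 (modelFourier η U) v := by
  induction U using TensorProduct.induction_on with
  | zero => simp
  | add U V hU hV => simp only [map_add, FourierTransform.fourier_add, add_apply, hU, hV]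
  | tmul k p => rw [modelSlice_tmul, modelFourier_tmul, FourierTransform.fourier_smul, map_smul,
      smul_apply, smul_apply, smul_eq_mul, smul_eq_mul, mul_comm]

lemma continuous_hermiteFun_modelFourier (U : PhaseModel n) :
    Continuous fun q : Ev n × Ev n => hermiteFun 0 (modelFourier q.1 U) q.2 := by
  induction U using TensorProduct.induction_on with
  | zero => simpa using continuous_const
  | add U V hU hV => 
    simp only [map_add, add_apply]
    exact hU.add hV
  | tmul k p =>
    simp only [modelFourier_tmul, map_smul, smul_apply]
    exact ((𝓕 k).continuous.comp continuous_fst).smul ((hermiteFun 0 p).continuous.comp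
      continuous_snd)

lemma enorm_toLp_sq {E : Type*} [NormedAddCommGroup E] [NormedSpace ℝ E] [MeasurableSpace E]
    [OpensMeasurableSpace E] [SecondCountableTopology E] (μ : Measure E) [μ.HasTemperateGrowth]
    (f : 𝓢(E, ℂ)) : ‖f.toLp 2 μ‖ₑ ^ 2 = ∫⁻ x, ‖f x‖ₑ ^ 2 ∂μ := by
  have h := eLpNorm_nnreal_pow_eq_lintegral (μ := μ) (f := f) (p := 2) two_ne_zero
  rw [Lp.enorm_def, eLpNorm_congr_ae (f.coeFn_toLp 2 μ)]
  simpa using h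

lemma enorm_modelEmb_sq (σ : ℝ) (U : PhaseModel n) :
    ‖(modelEmb n σ U).toLp 2 volume‖ₑ ^ 2 = ∫⁻ η : Ev n, ‖hermiteLp 0 (modelFourier η U)‖ₑ ^ 2 := by
  simp only [hermiteLp_apply, enorm_toLp_sq]
  rw [lintegral_lintegral_swap (by
    exact ((continuous_hermiteFun_modelFourier U).enorm.measurable.pow_const 2).aemeasurable)]
  rw [Measure.volume_eq_prod, lintegral_prod_symm' _
    ((modelEmb n σ U).continuous.enorm.measurable.pow_const 2)]
  refine lintegral_congr fun v => ?_
  simp only [modelEmb_apply]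
  rw [lintegral_sub_right_eq_self (fun x => ‖modelSlice v U x‖ₑ ^ 2)]
  simp only [← fourier_modelSlice, ← enorm_toLp_sq]
  simp only [← ofReal_norm, norm_fourier_toL2_eq]

lemma norm_modelEmb_le {z : ℂ} (hz : ¬(0 ≤ z.re ∧ z.im = 0)) : ∃ C : ℝ, 0 ≤ C ∧
    ∀ (σ : ℝ), σ ^ 2 = 1 → ∀ U : PhaseModel n, ‖(modelEmb n σ U).toLp 2 volume‖
      ≤ C * ‖(modelEmb n σ (modelOp n σ U - z • U)).toLp 2 volume‖ := by
  obtain ⟨C, hC, h⟩ := hermite_uniform_estimate n z hz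
  refine ⟨C, hC, fun σ hσ U => ?_⟩
  have key : ‖(modelEmb n σ U).toLp 2 volume‖ₑ ^ 2
      ≤ (ENNReal.ofReal C * ‖(modelEmb n σ (modelOp n σ U - z • U)).toLp 2 volume‖ₑ) ^ 2 := by
    rw [mul_pow, enorm_modelEmb_sq, enorm_modelEmb_sq, ← lintegral_const_mul' _ _ (by simp)]
    refine lintegral_mono fun η => ?_
    rw [← mul_pow, map_sub, map_smul, modelFourier_modelOp hσ]
    refine pow_le_pow_left' ?_ 2
    rw [← ofReal_norm, ← ofReal_norm, ← ENNReal.ofReal_mul hC]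
    exact ENNReal.ofReal_le_ofReal (h _ 0 _)
  rw [← ofReal_norm, ← ofReal_norm, ← ENNReal.ofReal_mul hC, ← ENNReal.ofReal_pow (by positivity),
    ← ENNReal.ofReal_pow (by positivity), ENNReal.ofReal_le_ofReal_iff (by positivity)] at key
  exact le_of_sq_le_sq key (by positivity)

end TensorModel

section ModelResolvent

open SchwartzMap LineDeriv FourierTransform
open scoped TensorProduct

lemma hasTemperateGrowth_inv_norm_sq_sub {H : Type*} [NormedAddCommGroup H]
    [InnerProductSpace ℝ H] {z : ℂ} (hz : ¬(0 ≤ z.re ∧ z.im = 0)) :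
    (fun x : H => (((‖x‖ ^ 2 : ℝ) : ℂ) - z)⁻¹).HasTemperateGrowth := by
  have hn : (fun x : H => ‖x‖ ^ 2).HasTemperateGrowth := Function.hasTemperateGrowth_norm_sq H
  by_cases him : z.im = 0
  · have hre : z.re < 0 := by
      by_contra h
      exact hz ⟨not_lt.1 h, him⟩
    have hs : 0 < √(-z.re) := Real.sqrt_pos.2 (by linarith)
    have h1 : (fun x : H => (1 + ‖(√(-z.re))⁻¹ • x‖ ^ 2) ^ (-1 : ℝ)).HasTemperateGrowth :=
      (Function.hasTemperateGrowth_one_add_norm_sq_rpow H (-1)).comp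
        ((√(-z.re))⁻¹ • ContinuousLinearMap.id ℝ H).hasTemperateGrowth
    have h2 : (fun x : H => ((-z.re)⁻¹ : ℂ)
        * (((1 + ‖(√(-z.re))⁻¹ • x‖ ^ 2) ^ (-1 : ℝ) : ℝ) : ℂ)).HasTemperateGrowth :=
      (Function.HasTemperateGrowth.const _).mul
        (Function.Complex.hasTemperateGrowth_ofReal.comp h1)
    have h3 : (fun x : H => (((‖x‖ ^ 2 : ℝ) : ℂ) - z)⁻¹) = fun x : H => ((-z.re)⁻¹ : ℂ)
        * (((1 + ‖(√(-z.re))⁻¹ • x‖ ^ 2) ^ (-1 : ℝ) : ℝ) : ℂ) := by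
      funext x
      have hz' : z = (z.re : ℂ) := Complex.ext rfl (by simpa using him)
      rw [Real.rpow_neg_one, norm_smul, mul_pow, norm_inv, inv_pow, Real.norm_of_nonneg hs.le,
        Real.sq_sqrt (by linarith)]
      nth_rewrite 1 [hz']
      norm_cast
      rw [← mul_inv]
      congr 1
      have : z.re ≠ 0 := hre.ne
      field_simp
      ring
    rw [h3]
    exact h2
  · have h0 : (fun x : H => (‖x‖ ^ 2 - z.re) / z.im).HasTemperateGrowth := by
      simp only [div_eq_mul_inv]
      exact (hn.sub (.const _)).mul (.const _)
    have h1 : (fun x : H => (1 + ‖(‖x‖ ^ 2 - z.re) / z.im‖ ^ 2) ^ (-1 : ℝ)).HasTemperateGrowth :=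
      (Function.hasTemperateGrowth_one_add_norm_sq_rpow ℝ (-1)).comp h0
    have h2 : (fun x : H => (((‖x‖ ^ 2 : ℝ) : ℂ) - (starRingEnd ℂ) z) * (((z.im ^ 2)⁻¹ : ℝ) : ℂ)
        * (((1 + ‖(‖x‖ ^ 2 - z.re) / z.im‖ ^ 2) ^ (-1 : ℝ) : ℝ) : ℂ)).HasTemperateGrowth :=
      (((Function.Complex.hasTemperateGrowth_ofReal.comp hn).sub (.const _)).mul (.const _)).mul
        (Function.Complex.hasTemperateGrowth_ofReal.comp h1)
    have h3 : (fun x : H => (((‖x‖ ^ 2 : ℝ) : ℂ) - z)⁻¹)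
        = fun x : H => (((‖x‖ ^ 2 : ℝ) : ℂ) - (starRingEnd ℂ) z) * (((z.im ^ 2)⁻¹ : ℝ) : ℂ)
        * (((1 + ‖(‖x‖ ^ 2 - z.re) / z.im‖ ^ 2) ^ (-1 : ℝ) : ℝ) : ℂ) := by
      funext x
      rw [Complex.inv_def, Real.rpow_neg_one, mul_assoc, ← Complex.ofReal_mul, ← mul_inv, map_sub,
        Complex.conj_ofReal]
      congr 3
      rw [Complex.normSq_apply, Real.norm_eq_abs, sq_abs]
      simp only [Complex.sub_re, Complex.ofReal_re, Complex.sub_im, Complex.ofReal_im]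
      field_simp
      ring
    rw [h3]
    exact h2

variable {n : ℕ}

lemma norm_sq_sub_ne_zero {H : Type*} [NormedAddCommGroup H] {z : ℂ}
    (hz : ¬(0 ≤ z.re ∧ z.im = 0)) (x : H) : ((‖x‖ ^ 2 : ℝ) : ℂ) - z ≠ 0 := by
  intro h
  rw [sub_eq_zero] at h
  exact hz (by rw [← h]; exact ⟨by rw [Complex.ofReal_re]; positivity, Complex.ofReal_im _⟩)

lemma exists_laplacian_resolvent {z : ℂ} (hz : ¬(0 ≤ z.re ∧ z.im = 0)) (k : 𝓢(Ev n, ℂ)) :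
    ∃ k' : 𝓢(Ev n, ℂ), -∑ j : Fin n, secondDeriv j k' - z • k' = k := by
  have hm : (fun η : Ev n => (((‖(2 * π) • η‖ ^ 2 : ℝ) : ℂ) - z)⁻¹).HasTemperateGrowth :=
    (hasTemperateGrowth_inv_norm_sq_sub hz).comp
      ((2 * π) • ContinuousLinearMap.id ℝ (Ev n)).hasTemperateGrowth
  refine ⟨𝓕⁻ (smulLeftCLM ℂ (fun η : Ev n => (((‖(2 * π) • η‖ ^ 2 : ℝ) : ℂ) - z)⁻¹) (𝓕 k)), ?_⟩
  apply (fourierCLE ℂ 𝓢(Ev n, ℂ)).injective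
  ext η
  rw [map_sub, map_neg, map_smul]
  simp only [fourierCLE_apply]
  rw [sub_apply, neg_apply, smul_apply, fourier_sum_secondDeriv,
    FourierTransform.fourier_fourierInv_eq, smulLeftCLM_apply_apply hm]
  have h := norm_sq_sub_ne_zero hz ((2 * π) • η)
  simp only [smul_eq_mul]
  field_simp

/-- The model operator shifted by `z`. -/
def modelOpSub (n : ℕ) (σ : ℝ) (z : ℂ) : PhaseModel n →ₗ[ℂ] PhaseModel n :=
  modelOp n σ - z • LinearMap.id

lemma modelOpSub_apply (σ : ℝ) (z : ℂ) (U : PhaseModel n) :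
    modelOpSub n σ z U = modelOp n σ U - z • U := rfl

lemma modelOpSub_surjective (σ : ℝ) {z : ℂ} (hz : ¬(0 ≤ z.re ∧ z.im = 0)) :
    Function.Surjective (modelOpSub n σ z) := by
  obtain ⟨W, hW0, hW, ha, hnum⟩ := exists_hermite_filtration n
  have key (d : ℕ) : ∀ p ∈ W d, ∀ k : 𝓢(Ev n, ℂ), k ⊗ₜ p ∈ LinearMap.range (modelOpSub n σ z) := by
    induction d with
    | zero =>
      intro p hp k
      rw [hW0, Submodule.mem_bot] at hp
      rw [hp, TensorProduct.tmul_zero]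
      exact Submodule.zero_mem _
    | succ d ih =>
      intro p hp k
      obtain ⟨k', hk'⟩ := exists_laplacian_resolvent (z := z - d) (by
        rintro ⟨h1, h2⟩
        simp only [Complex.sub_re, Complex.natCast_re, Complex.sub_im, Complex.natCast_im,
          sub_zero] at h1 h2
        exact hz ⟨by linarith [Nat.cast_nonneg (α := ℝ) d], h2⟩) k
      have h : k ⊗ₜ p = modelOpSub n σ z (k' ⊗ₜ p)
          - k' ⊗ₜ[ℂ] ((hermiteSystem n).num p - (d : ℂ) • p)
          - ∑ j : Fin n, (2 * σ : ℂ) • (∂_{EuclideanSpace.single j (1 : ℝ)} k')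
            ⊗ₜ[ℂ] (hermiteSystem n).a j p := by
        rw [modelOpSub_apply, modelOp_tmul, ← hk', TensorProduct.tmul_sub, TensorProduct.tmul_smul,
          TensorProduct.sub_tmul, TensorProduct.neg_tmul, ← TensorProduct.smul_tmul' (z - d)]
        module
      rw [h]
      refine Submodule.sub_mem _ (Submodule.sub_mem _ (LinearMap.mem_range_self _ _) ?_) ?_
      · exact ih _ (hnum d p hp) k'
      · exact Submodule.sum_mem _ fun j _ => Submodule.smul_mem _ _ (ih _ (ha d j p hp) _)
  rw [← LinearMap.range_eq_top, eq_top_iff]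
  intro U _
  induction U using TensorProduct.induction_on with
  | zero => exact Submodule.zero_mem _
  | add U V hU hV => exact Submodule.add_mem _ (hU trivial) (hV trivial)
  | tmul k p =>
    obtain ⟨d, hd⟩ := hW p
    exact key d p hd k

end ModelResolvent

section PhaseDensity

open SchwartzMap
open scoped TensorProduct ContDiff

variable {n : ℕ}

lemma measurePreserving_shear (n : ℕ) (σ : ℝ) :
    MeasurePreserving (shear (Ev n) σ) (volume : Measure (PhaseN n)) volume := by
  have h : MeasurePreserving (fun p : Ev n × Ev n => (p.1, p.2 - σ • p.1))
      (volume.prod volume) (volume.prod volume) := by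
    refine (MeasurePreserving.id volume).skew_product (g := fun v x => x - σ • v) ?_ ?_
    · fun_prop
    · exact Eventually.of_forall fun v => map_sub_right_eq_self volume (σ • v)
  have h' := (Measure.measurePreserving_swap.comp h).comp
    (Measure.measurePreserving_swap (μ := (volume : Measure (Ev n))) (ν := volume))
  exact h'

lemma ae_eq_zero_of_forall_integral_tensor {F : PhaseN n → ℂ} (hF : MemLp F 2 volume)
    (h : ∀ (k : 𝓢(Ev n, ℂ)) (p : MvPolynomial (Fin n) ℂ),
      ∫ x, F x * shearTensor 0 k (hermiteFun 0 p) x = 0) : F =ᵐ[volume] 0 := by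
  have hFint (k g : 𝓢(Ev n, ℂ)) :
      Integrable (fun x => F x * shearTensor 0 k g x) (volume.prod volume) :=
    MemLp.integrable_mul (p := 2) (q := 2) hF ((shearTensor 0 k g).memLp 2 volume)
  let γ : 𝓢(Ev n, ℂ) := hermiteFun 0 1
  have hγ (x : Ev n) : γ x ≠ 0 := by
    simp only [γ, hermiteFun_apply]
    simp [polyEval]
  have hslice (p : MvPolynomial (Fin n) ℂ) :
      ∀ᵐ x : Ev n, ∫ v, F (x, v) * hermiteFun 0 p v = 0 := by
    have hG := (hFint γ (hermiteFun 0 p)).integral_prod_left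
    have h0 : ∀ᵐ x : Ev n, ∫ v, F (x, v) * shearTensor 0 γ (hermiteFun 0 p) (x, v) = 0 := by
      refine ae_eq_zero_of_integral_contDiff_smul_eq_zero hG.locallyIntegrable fun g hg hgc => ?_
      have hg1 : ContDiff ℝ ∞ fun x => (g x : ℂ) * γ x :=
        (Complex.ofRealCLM.contDiff.comp hg).mul (γ.smooth ⊤)
      have hg2 : HasCompactSupport fun x => (g x : ℂ) * γ x :=
        (hgc.comp_left (g := fun y : ℝ => (y : ℂ)) (by simp)).mul_right
      have h1 := h (hg2.toSchwartzMap hg1) p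
      rw [Measure.volume_eq_prod, integral_prod _ (hFint _ _)] at h1
      rw [← h1]
      refine integral_congr_ae (Eventually.of_forall fun x => ?_)
      simp only [Complex.real_smul, ← integral_const_mul]
      refine integral_congr_ae (Eventually.of_forall fun v => ?_)
      simp only [shearTensor_apply, zero_smul, sub_zero]
      change _ = F (x, v) * (((g x : ℂ) * γ x) * hermiteFun 0 p v)
      ring
    filter_upwards [h0] with x hx
    have h2 : ∫ v, F (x, v) * shearTensor 0 γ (hermiteFun 0 p) (x, v)
        = γ x * ∫ v, F (x, v) * hermiteFun 0 p v := by
      rw [← integral_const_mul]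
      refine integral_congr_ae (Eventually.of_forall fun v => ?_)
      simp only [shearTensor_apply, zero_smul, sub_zero]
      ring
    rw [h2] at hx
    exact (mul_eq_zero.1 hx).resolve_left (hγ x)
  have hmon : ∀ᵐ x : Ev n, ∀ s : Fin n →₀ ℕ,
      ∫ v, F (x, v) * hermiteFun 0 (MvPolynomial.monomial s 1) v = 0 :=
    ae_all_iff.2 fun s => hslice _
  have hm : ∀ᵐ x : Ev n, AEStronglyMeasurable (fun v => F (x, v)) volume :=
    hF.aestronglyMeasurable.prodMk_left
  have hsq : ∀ᵐ x : Ev n, Integrable (fun v => ‖F (x, v)‖ ^ 2) volume :=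
    ((memLp_two_iff_integrable_sq_norm hF.aestronglyMeasurable).1 hF).prod_right_ae
  have hzero : ∀ᵐ x : Ev n, ∀ᵐ v : Ev n, F (x, v) = 0 := by
    filter_upwards [hmon, hm, hsq] with x hx hmx hsx
    have hL : MemLp (fun v => F (x, v)) 2 volume := (memLp_two_iff_integrable_sq_norm hmx).2 hsx
    have hcoe (p : MvPolynomial (Fin n) ℂ) : ∫ v, hL.toLp _ v * hermiteFun 0 p v
        = ∫ v, F (x, v) * hermiteFun 0 p v := by
      refine integral_congr_ae ?_
      filter_upwards [hL.coeFn_toLp] with v hv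
      rw [hv]
    have hg : hL.toLp _ = 0 := by
      refine eq_zero_of_forall_integral_hermiteFun 0 _ fun p => ?_
      rw [integral_mul_schwartz, ← hermiteLp_apply, p.as_sum, map_sum, inner_sum]
      refine Finset.sum_eq_zero fun s _ => ?_
      rw [← mul_one (p.coeff s), ← smul_eq_mul, ← MvPolynomial.smul_monomial, map_smul,
        inner_smul_right, hermiteLp_apply, ← integral_mul_schwartz, hcoe, hx s, mul_zero]
    filter_upwards [hL.coeFn_toLp, Lp.coeFn_zero ℂ 2 (volume : Measure (Ev n))] with v h1 h2
    rw [← h1, hg, h2, Pi.zero_apply]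
  have hFm : AEMeasurable (fun x => ‖F x‖ₑ) (volume.prod volume) := hF.aestronglyMeasurable.enorm
  have h3 : ∫⁻ x, ‖F x‖ₑ = 0 := by
    rw [Measure.volume_eq_prod, lintegral_prod _ hFm]
    refine (lintegral_congr_ae ?_).trans lintegral_zero
    filter_upwards [hzero] with x hx
    refine (lintegral_congr_ae ?_).trans lintegral_zero
    filter_upwards [hx] with v hv
    rw [hv, enorm_zero]
  filter_upwards [(lintegral_eq_zero_iff' hFm).1 h3] with x hx
  exact enorm_eq_zero.1 hx

lemma denseRange_modelEmb (n : ℕ) (σ : ℝ) :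
    DenseRange fun U => (modelEmb n σ U).toLp 2 (volume : Measure (PhaseN n)) := by
  let e := (toLpCLM ℂ ℂ 2 (volume : Measure (PhaseN n))).toLinearMap ∘ₗ modelEmb n σ
  have h : Dense ((LinearMap.range e : Submodule ℂ (HspN n)) : Set (HspN n)) := by
    rw [Submodule.dense_iff_topologicalClosure_eq_top, Submodule.topologicalClosure_eq_top_iff,
      eq_bot_iff]
    intro f hf
    have hS : MeasurePreserving (shear (Ev n) σ).symm (volume : Measure (PhaseN n)) volume :=
      (measurePreserving_shear n σ).symm (shear (Ev n) σ).toHomeomorph.toMeasurableEquiv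
    have hS' := hS.integral_comp (G := ℂ) (shear (Ev n) σ).symm.toHomeomorph.measurableEmbedding
    have horth (U : PhaseModel n) : ∫ x, (star f : HspN n) x * modelEmb n σ U x = 0 := by
      rw [integral_mul_schwartz, star_star]
      exact Submodule.inner_left_of_mem_orthogonal (LinearMap.mem_range_self e U) hf
    obtain ⟨g, hg⟩ : ∃ g : HspN n, g = star f := ⟨_, rfl⟩
    rw [← hg] at horth
    have h0 : (g ∘ (shear (Ev n) σ).symm : PhaseN n → ℂ) =ᵐ[volume] 0 := by
      refine ae_eq_zero_of_forall_integral_tensor ((Lp.memLp g).comp_measurePreserving hS)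
        fun k p => ?_
      rw [← horth (k ⊗ₜ p), ← hS' fun x => g x * modelEmb n σ (k ⊗ₜ p) x]
      refine integral_congr_ae (Eventually.of_forall fun x => ?_)
      obtain ⟨y, rfl⟩ : ∃ y, shear (Ev n) σ y = x := ⟨_, (shear (Ev n) σ).apply_symm_apply x⟩
      simp only [Function.comp_apply, ContinuousLinearEquiv.symm_apply_apply, modelEmb_tmul]
      simp [shearTensor_apply, shear_apply]
    have h1 : g = 0 := by
      refine (Lp.eq_zero_iff_ae_eq_zero).2 ?_
      filter_upwards [(measurePreserving_shear n σ).quasiMeasurePreserving.ae h0] with x hx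
      simpa using hx
    rw [hg] at h1
    rw [Submodule.mem_bot, ← norm_eq_zero, ← norm_star_Lp, h1, norm_zero]
  rwa [LinearMap.coe_range] at h

end PhaseDensity

section PhaseResolvent

open SchwartzMap
open scoped TensorProduct ContDiff

variable {n : ℕ}

/-- The operator `kfpOp` shifted by `z`. -/
def kfpOpSub (n : ℕ) (σ : ℝ) (z : ℂ) : 𝓢(PhaseN n, ℂ) →L[ℂ] 𝓢(PhaseN n, ℂ) :=
  kfpOp n σ - z • ContinuousLinearMap.id ℂ _

lemma schwartzPair_kfpOpSub (σ : ℝ) (z : ℂ) (f g : 𝓢(PhaseN n, ℂ)) :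
    schwartzPair volume (kfpOpSub n σ z f) g
      = schwartzPair volume f (kfpOpSub n (-σ) z g) := by
  simp only [kfpOpSub, sub_apply, smul_apply, ContinuousLinearMap.id_apply,
    map_sub, map_smul, LinearMap.sub_apply, LinearMap.smul_apply, schwartzPair_kfpOp]

lemma kfpOpSub_neg_one_apply (z : ℂ) (φ : 𝓢(PhaseN n, ℂ)) (p : PhaseN n) :
    kfpOpSub n (-1) z φ p = KFP0tN n φ p - z * φ p := by
  rw [← kfpOp_neg_one_apply]
  simp [kfpOpSub]

lemma kfpOpSub_modelEmb {σ : ℝ} (hσ : σ ^ 2 = 1) (z : ℂ) (U : PhaseModel n) :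
    kfpOpSub n σ z (modelEmb n σ U) = modelEmb n σ (modelOpSub n σ z U) := by
  rw [kfpOpSub, sub_apply, smul_apply, kfpOp_modelEmb hσ, modelOpSub_apply, map_sub,
    map_smul]
  rfl

lemma IsTestN.toSchwartz {φ : PhaseN n → ℂ} (hφ : IsTestN n φ) :
    ∃ ψ : 𝓢(PhaseN n, ℂ), (ψ : PhaseN n → ℂ) = φ :=
  ⟨hφ.2.toSchwartzMap hφ.1, rfl⟩

lemma exists_kfp_resolvent {z : ℂ} (hz : ¬(0 ≤ z.re ∧ z.im = 0)) :
    ∃ R : HspN n →L[ℂ] HspN n,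
      (∀ (f : HspN n) (φ : PhaseN n → ℂ), IsTestN n φ →
        ∫ p, (R f) p * (KFP0tN n φ p - z * φ p) = ∫ p, f p * φ p) ∧
      (∀ u w : HspN n, (∀ φ : PhaseN n → ℂ, IsTestN n φ →
        ∫ p, u p * (KFP0tN n φ p - z * φ p) = ∫ p, w p * φ p) → R w = u) := by
  obtain ⟨C, hC, hbound⟩ := norm_modelEmb_le (n := n) hz
  obtain ⟨R, hR, -⟩ := exists_resolvent
    ((toLpCLM ℂ ℂ 2 (volume : Measure (PhaseN n))).toLinearMap ∘ₗ modelEmb n 1)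
    (modelOpSub n 1 z) (denseRange_modelEmb n 1) (modelOpSub_surjective 1 hz) hC
    (hbound 1 (by norm_num))
  have hweak (f : HspN n) (ψ : 𝓢(PhaseN n, ℂ)) :
      ∫ p, (R f) p * kfpOpSub n (-1) z ψ p = ∫ p, f p * ψ p :=
    integral_apply_mul_of_resolvent (denseRange_modelEmb n 1) (modelOpSub_surjective 1 hz) hR
      (schwartzPair_kfpOpSub 1 z) (kfpOpSub_modelEmb (by norm_num) z) f ψ
  refine ⟨R, fun f φ hφ => ?_, fun u w huw => ?_⟩
  · obtain ⟨ψ, rfl⟩ := hφ.toSchwartz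
    simp only [← kfpOpSub_neg_one_apply]
    exact hweak f ψ
  · refine eq_of_forall_integral_mul_eq (denseRange_modelEmb n (-1)) _ _ fun U => ?_
    obtain ⟨V, rfl⟩ := modelOpSub_surjective (-1) hz U
    rw [← kfpOpSub_modelEmb (by norm_num), hweak]
    refine (weak_eq_schwartz (kfpOpSub n (-1) z) u w (fun φ hφ => ?_) _).symm
    simpa only [kfpOpSub_neg_one_apply] using huw φ ⟨φ.smooth ⊤, hφ⟩

end PhaseResolvent

section PhaseSpectrum

open SchwartzMap FourierTransform
open scoped TensorProduct ContDiff

variable {n : ℕ}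

lemma modelOpSub_tmul_one (σ : ℝ) (z : ℂ) (k : 𝓢(Ev n, ℂ)) :
    modelOpSub n σ z (k ⊗ₜ 1) = (-∑ j : Fin n, secondDeriv j k - z • k) ⊗ₜ[ℂ] 1 := by
  have ha (j : Fin n) : (hermiteSystem n).a j 1 = 0 := MvPolynomial.pderiv_one
  rw [modelOpSub_apply, modelOp_tmul, CCRSystem.num_apply, TensorProduct.sub_tmul,
    TensorProduct.neg_tmul, TensorProduct.smul_tmul']
  simp [ha]

lemma norm_modelEmb_tmul_one_le (σ : ℝ) {k l : 𝓢(Ev n, ℂ)} {C : ℝ} (hC : 0 ≤ C)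
    (h : ∀ η, ‖𝓕 k η‖ ≤ C * ‖𝓕 l η‖) :
    ‖(modelEmb n σ (k ⊗ₜ 1)).toLp 2 volume‖ ≤ C * ‖(modelEmb n σ (l ⊗ₜ 1)).toLp 2 volume‖ := by
  have hsq : ‖(modelEmb n σ (k ⊗ₜ 1)).toLp 2 volume‖ₑ ^ 2
      ≤ (ENNReal.ofReal C * ‖(modelEmb n σ (l ⊗ₜ 1)).toLp 2 volume‖ₑ) ^ 2 := by
    rw [mul_pow, enorm_modelEmb_sq, enorm_modelEmb_sq, ← lintegral_const_mul' _ _ (by simp)]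
    refine lintegral_mono fun η => ?_
    rw [← mul_pow, modelFourier_tmul, modelFourier_tmul, map_smul, map_smul, ← ofReal_norm,
      ← ofReal_norm, ← ENNReal.ofReal_mul hC, norm_smul, norm_smul, ← mul_assoc]
    gcongr
    exact h η
  have h2 := (ENNReal.pow_le_pow_left_iff two_ne_zero).1 hsq
  rw [← ofReal_norm, ← ofReal_norm, ← ENNReal.ofReal_mul hC] at h2
  exact (ENNReal.ofReal_le_ofReal_iff (by positivity)).1 h2

lemma modelEmb_tmul_one_ne_zero (σ : ℝ) {k : 𝓢(Ev n, ℂ)} (hk : k ≠ 0) :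
    (modelEmb n σ (k ⊗ₜ 1)).toLp 2 (volume : Measure (PhaseN n)) ≠ 0 := by
  contrapose! hk
  have h0 : modelEmb n σ (k ⊗ₜ 1) = 0 := by
    apply injective_toLp (F := ℂ) 2 (volume : Measure (PhaseN n))
    refine hk.trans ?_
    exact (map_zero (toLpCLM ℂ ℂ 2 (volume : Measure (PhaseN n)))).symm
  ext x
  have h1 := DFunLike.congr_fun h0 (x, 0)
  rw [modelEmb_tmul, shearTensor_apply] at h1
  simpa [hermiteFun_apply, polyEval] using h1

/-- A nonzero Schwartz function whose Fourier transform is concentrated near the sphere on which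
the symbol of the Laplacian takes the value `-r`. -/
lemma exists_approx_eigenfunction (hn : 1 ≤ n) {r ε : ℝ} (hr : 0 ≤ r) (hε : 0 < ε) :
    ∃ k : 𝓢(Ev n, ℂ), k ≠ 0 ∧
      ∀ η, ‖𝓕 (-∑ j : Fin n, secondDeriv j k - (r : ℂ) • k) η‖ ≤ ε * ‖𝓕 k η‖ := by
  let η₀ : Ev n := EuclideanSpace.single ⟨0, hn⟩ (√r / (2 * π))
  have hη₀ : ‖(2 * π) • η₀‖ ^ 2 = r := by
    rw [norm_smul, PiLp.norm_single, Real.norm_of_nonneg (by positivity),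
      Real.norm_of_nonneg (by positivity), mul_div_cancel₀ _ (by positivity), Real.sq_sqrt hr]
  have hs : {η : Ev n | |‖(2 * π) • η‖ ^ 2 - r| < ε} ∈ 𝓝 η₀ := by
    refine IsOpen.mem_nhds (isOpen_lt (by fun_prop) continuous_const) ?_
    change |‖(2 * π) • η₀‖ ^ 2 - r| < ε
    rwa [hη₀, sub_self, abs_zero]
  obtain ⟨f, hfs, hfc, hf, -, hf1⟩ := exists_contDiff_tsupport_subset (n := ⊤) hs
  let g : 𝓢(Ev n, ℂ) := (hfc.comp_left (g := fun y : ℝ => (y : ℂ)) (by simp)).toSchwartzMap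
    (Complex.ofRealCLM.contDiff.comp hf)
  have hg (η : Ev n) : g η = (f η : ℂ) := rfl
  have hFg : 𝓕 (𝓕⁻ g) = g := fourier_fourierInv_eq g
  refine ⟨𝓕⁻ g, fun h => ?_, fun η => ?_⟩
  · have h1 : g η₀ = 0 := by
      rw [← hFg, h]
      simp
    simp [hg, hf1] at h1
  · have hlin : 𝓕 (-∑ j : Fin n, secondDeriv j (𝓕⁻ g) - (r : ℂ) • 𝓕⁻ g)
        = -𝓕 (∑ j : Fin n, secondDeriv j (𝓕⁻ g)) - (r : ℂ) • 𝓕 (𝓕⁻ g) := by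
      simp only [← fourierCLM_apply (R := ℂ), map_sub, map_neg, map_smul]
    rw [hlin, sub_apply, neg_apply, smul_apply, fourier_sum_secondDeriv, hFg, neg_mul, neg_neg,
      smul_eq_mul, ← sub_mul, ← Complex.ofReal_sub, norm_mul, Complex.norm_real]
    by_cases hη : f η = 0
    · simp [hg, hη]
    · gcongr
      exact (hfs (subset_tsupport f hη)).le

lemma not_exists_kfp_resolvent (hn : 1 ≤ n) {r : ℝ} (hr : 0 ≤ r) (R : HspN n →L[ℂ] HspN n)
    (hR : ∀ u w : HspN n, (∀ φ : PhaseN n → ℂ, IsTestN n φ →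
      ∫ p, u p * (KFP0tN n φ p - (r : ℂ) * φ p) = ∫ p, w p * φ p) → R w = u) : False := by
  have hε : 0 < (2 * (‖R‖ + 1))⁻¹ := by positivity
  obtain ⟨k, hk, hkε⟩ := exists_approx_eigenfunction hn hr hε
  have hRk : R ((modelEmb n 1 (modelOpSub n 1 r (k ⊗ₜ 1))).toLp 2 volume)
      = (modelEmb n 1 (k ⊗ₜ 1)).toLp 2 volume := by
    refine hR _ _ fun φ hφ => ?_
    obtain ⟨ψ, rfl⟩ := hφ.toSchwartz
    simp only [← kfpOpSub_neg_one_apply]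
    rw [integral_toLp_mul, integral_toLp_mul, ← schwartzPair_apply, ← schwartzPair_apply,
      ← schwartzPair_kfpOpSub, kfpOpSub_modelEmb (by norm_num)]
  have h1 := norm_modelEmb_tmul_one_le 1 hε.le hkε
  have h2 := R.le_opNorm ((modelEmb n 1 (modelOpSub n 1 r (k ⊗ₜ 1))).toLp 2 volume)
  rw [hRk, modelOpSub_tmul_one] at h2
  have h3 := norm_pos_iff.2 (modelEmb_tmul_one_ne_zero 1 hk)
  set N := ‖(modelEmb n 1 (k ⊗ₜ 1)).toLp 2 volume‖
  have h4 : N ≤ ‖R‖ * ((2 * (‖R‖ + 1))⁻¹ * N) := h2.trans (by gcongr)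
  have h5 : ‖R‖ * (2 * (‖R‖ + 1))⁻¹ < 1 := by
    rw [← div_eq_mul_inv, div_lt_one (by positivity)]
    linarith [norm_nonneg R]
  nlinarith

end PhaseSpectrum

/-- **Section 2, (2.14)–(2.15)**.  For every z ∈ ℂ∖[0,∞) there is C_z with
sup_ξ ‖(P̂₀(ξ)−z)^{−1}‖ ≤ C_z; consequently σ(P₀) = ⋃_ξ σ(P̂₀(ξ)) = [0,∞).
A point z lies outside σ(P₀) iff P₀ − z has a bounded two-sided inverse (in the
distributional sense, on the maximal domain). -/
theorem statement7 (n : ℕ) (hn : 1 ≤ n) :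
    -- uniform resolvent estimate for the complex harmonic oscillators :
    (∀ z : ℂ, ¬(0 ≤ z.re ∧ z.im = 0) → ∃ C : ℝ,
      (∀ ξ : Ev n, ∃ R : HV n →L[ℂ] HV n, IsResV n ξ z R) ∧
      (∀ ξ : Ev n, ∀ R : HV n →L[ℂ] HV n, IsResV n ξ z R → ‖R‖ ≤ C)) ∧
    -- σ(P₀) = [0,∞) :
    ({z : ℂ | ¬∃ R : HspN n →L[ℂ] HspN n,
        (∀ f : HspN n, ∀ φ : PhaseN n → ℂ, IsTestN n φ →
          ∫ p : PhaseN n, (R f) p * (KFP0tN n φ p - z * φ p)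
            = ∫ p : PhaseN n, f p * φ p) ∧
        (∀ u w : HspN n,
          (∀ φ : PhaseN n → ℂ, IsTestN n φ →
            ∫ p : PhaseN n, u p * (KFP0tN n φ p - z * φ p) = ∫ p : PhaseN n, w p * φ p) →
          R w = u)}
      = {z : ℂ | ∃ r : ℝ, 0 ≤ r ∧ z = (r : ℂ)}) := by
  refine ⟨fun z hz => ?_, ?_⟩
  · obtain ⟨C, hC⟩ := exists_forall_isResV_norm_le (n := n) hz
    exact ⟨C, exists_isResV hz, hC⟩
  · ext z
    refine ⟨fun h => ?_, ?_⟩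
    · by_contra hz
      refine h (exists_kfp_resolvent fun h0 => hz ⟨z.re, h0.1, ?_⟩)
      exact Complex.ext (by simp) (by simpa using h0.2)
    · rintro ⟨r, hr, rfl⟩ ⟨R, -, hR⟩
      exact not_exists_kfp_resolvent hn hr R hR

end
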